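/- arXiv:1710.00809 — 5 statements merged into one kernel-verified Lean document; each statement's English description precedes it below -/
import Mathlib

section
/- Interference lower bound (Lemma 1): Assume K ≥ M + 2. Under the scheme hypotheses (independence, answer determinism, privacy, ε-reliability), the download cost satisfies D − ℓ + 2ε ≥ I(W_{M+2}, …, W_K ; Q_1^[M+1], …, Q_N^[M+1], A_1^[M+1], …, A_N^[M+1] | W_1, …, W_{M+1}). -/
open MeasureTheory

noncomputable def entH {Ω : Type*} [MeasurableSpace Ω] (μ : Measure Ω)
    {S : Type*} [Fintype S] (X : Ω → S) : ℝ :=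
  ∑ s : S, Real.negMulLog (μ (X ⁻¹' {s})).toReal

noncomputable def condH {Ω : Type*} [MeasurableSpace Ω] (μ : Measure Ω)
    {S T : Type*} [Fintype S] [Fintype T] (X : Ω → S) (Y : Ω → T) : ℝ :=
  entH μ (fun ω => (X ω, Y ω)) - entH μ Y

noncomputable def condMI {Ω : Type*} [MeasurableSpace Ω] (μ : Measure Ω)
    {S T U : Type*} [Fintype S] [Fintype T] [Fintype U]
    (X : Ω → S) (Y : Ω → T) (Z : Ω → U) : ℝ :=
  condH μ X Z + condH μ Y Z - condH μ (fun ω => (X ω, Y ω)) Z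

def SchemeHyps (N K M : ℕ) {Ω : Type*} [MeasurableSpace Ω] (μ : Measure Ω)
    {S T U : Type*} [Fintype S] [Fintype T] [Fintype U]
    [MeasurableSpace S] [MeasurableSpace T] [MeasurableSpace U]
    [MeasurableSingletonClass S] [MeasurableSingletonClass T] [MeasurableSingletonClass U]
    (W : Fin K → Ω → S) (Q : Fin K → Fin N → Ω → T) (A : Fin K → Fin N → Ω → U)
    (ℓ ε : ℝ) : Prop :=
  IsProbabilityMeasure μ ∧
  (∀ i, Measurable (W i)) ∧
  (∀ (k : Fin K) (n : Fin N), Measurable (Q k n)) ∧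
  (∀ (k : Fin K) (n : Fin N), Measurable (A k n)) ∧
  (∀ i, entH μ (W i) = ℓ) ∧
  (∀ w : Fin K → S, μ {ω | ∀ i, W i ω = w i} = ∏ i, μ {ω | W i ω = w i}) ∧
  (∀ k : Fin K, M ≤ (k : ℕ) → ∀ (q : Fin N → T) (w : Fin K → S),
    μ {ω | (∀ n, Q k n ω = q n) ∧ (∀ i, W i ω = w i)} =
      μ {ω | ∀ n, Q k n ω = q n} * μ {ω | ∀ i, W i ω = w i}) ∧
  (∀ k : Fin K, M ≤ (k : ℕ) → ∀ n : Fin N,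
    condH μ (A k n) (fun ω => (Q k n ω, fun i => W i ω)) = 0) ∧
  (∀ (n : Fin N) (k k' : Fin K), M ≤ (k : ℕ) → M ≤ (k' : ℕ) →
    ∀ (t : T) (u : U) (w : Fin K → S),
      μ {ω | Q k n ω = t ∧ A k n ω = u ∧ ∀ i, W i ω = w i} =
        μ {ω | Q k' n ω = t ∧ A k' n ω = u ∧ ∀ i, W i ω = w i}) ∧
  (∀ k : Fin K, M ≤ (k : ℕ) →
    condH μ (W k) (fun ω =>
      ((fun n => Q k n ω), (fun n => A k n ω),
       (fun i : {i : Fin K // (i : ℕ) < M} => W i.1 ω))) ≤ ε)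

section EntropyInequalities

variable {Ω : Type*} [MeasurableSpace Ω] {μ : Measure Ω}
  {S T : Type*} [Fintype S] [Fintype T]

lemma entH_eq_sum_mul_neg_log (X : Ω → S) :
    entH μ X = ∑ s, μ.real (X ⁻¹' {s}) * -Real.log (μ.real (X ⁻¹' {s})) := by
  simp [entH, Real.negMulLog, Measure.real]

variable [MeasurableSpace S] [MeasurableSingletonClass S]

/-- Change of variables for the law of `f ∘ X`. -/
lemma sum_measureReal_preimage_mul_comp [IsFiniteMeasure μ] {X : Ω → S} (hX : Measurable X)
    (f : S → T) (g : T → ℝ) :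
    ∑ s, μ.real (X ⁻¹' {s}) * g (f s) = ∑ t, μ.real ((f ∘ X) ⁻¹' {t}) * g t := by
  classical
  rw [← Finset.sum_fiberwise Finset.univ f]
  refine Finset.sum_congr rfl fun t _ => ?_
  have h := sum_measureReal_preimage_singleton (μ := μ) (f := X)
    (Finset.univ.filter fun s => f s = t) fun s _ => hX (measurableSet_singleton s)
  have hset : (f ∘ X) ⁻¹' {t} = X ⁻¹' ↑(Finset.univ.filter fun s => f s = t) := by
    ext ω; simp
  rw [hset, ← h, Finset.sum_mul]
  refine Finset.sum_congr rfl fun s hs => ?_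
  rw [(Finset.mem_filter.1 hs).2]

lemma sum_measureReal_preimage [IsProbabilityMeasure μ] {X : Ω → S} (hX : Measurable X) :
    ∑ s, μ.real (X ⁻¹' {s}) = 1 := by
  have h := sum_measureReal_preimage_singleton (μ := μ) (f := X) Finset.univ
    fun s _ => hX (measurableSet_singleton s)
  simpa using h

/-- Entropy does not increase under a deterministic function. -/
lemma entH_le_of_eq_comp [IsFiniteMeasure μ] {X : Ω → S} (hX : Measurable X) {Y : Ω → T}
    (f : S → T) (hY : ∀ ω, Y ω = f (X ω)) : entH μ Y ≤ entH μ X := by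
  obtain rfl : Y = f ∘ X := funext hY
  rw [entH_eq_sum_mul_neg_log, entH_eq_sum_mul_neg_log,
    ← sum_measureReal_preimage_mul_comp hX f fun t => -Real.log (μ.real ((f ∘ X) ⁻¹' {t}))]
  refine Finset.sum_le_sum fun s _ => ?_
  rcases (measureReal_nonneg (μ := μ) (s := X ⁻¹' {s})).eq_or_lt with h | h
  · simp [← h]
  · have hle : μ.real (X ⁻¹' {s}) ≤ μ.real ((f ∘ X) ⁻¹' {f s}) :=
      measureReal_mono fun ω hω => congrArg f hω
    exact mul_le_mul_of_nonneg_left (neg_le_neg (Real.log_le_log h hle)) h.le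

/-- Gibbs' inequality. -/
lemma entH_le_sum_mul_neg_log [IsProbabilityMeasure μ] {X : Ω → S} (hX : Measurable X)
    (q : S → ℝ) (hq : ∀ s, 0 ≤ q s) (hsum : ∑ s, q s ≤ 1)
    (hac : ∀ s, q s = 0 → μ.real (X ⁻¹' {s}) = 0) :
    entH μ X ≤ ∑ s, μ.real (X ⁻¹' {s}) * -Real.log (q s) := by
  have key : ∀ s, μ.real (X ⁻¹' {s}) * -Real.log (μ.real (X ⁻¹' {s})) ≤
      μ.real (X ⁻¹' {s}) * -Real.log (q s) + (q s - μ.real (X ⁻¹' {s})) := by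
    intro s
    rcases (measureReal_nonneg (μ := μ) (s := X ⁻¹' {s})).eq_or_lt with h | h
    · simp [← h, hq s]
    · have hqs : 0 < q s := (hq s).lt_of_ne fun h0 => h.ne' (hac s h0.symm)
      have hlog := Real.log_le_sub_one_of_pos (div_pos hqs h)
      rw [Real.log_div hqs.ne' h.ne'] at hlog
      have hmul := mul_le_mul_of_nonneg_left hlog h.le
      rw [mul_sub, mul_sub, mul_div_cancel₀ _ h.ne'] at hmul
      linarith
  have h := Finset.sum_le_sum fun s (_ : s ∈ Finset.univ) => key s
  rw [Finset.sum_add_distrib, Finset.sum_sub_distrib, sum_measureReal_preimage hX] at h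
  rw [entH_eq_sum_mul_neg_log]
  linarith

section Pair

variable [MeasurableSpace T] [MeasurableSingletonClass T]
  {X : Ω → S} {Y : Ω → T}

lemma sum_prod_mul_neg_log [IsProbabilityMeasure μ] (hX : Measurable X) (hY : Measurable Y) :
    ∑ z : S × T, μ.real ((fun ω => (X ω, Y ω)) ⁻¹' {z}) *
      -Real.log (μ.real (X ⁻¹' {z.1}) * μ.real (Y ⁻¹' {z.2})) = entH μ X + entH μ Y := by
  have hXY : Measurable fun ω => (X ω, Y ω) := hX.prodMk hY
  have h₁ := sum_measureReal_preimage_mul_comp (μ := μ) hXY Prod.fst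
    fun s => -Real.log (μ.real (X ⁻¹' {s}))
  have h₂ := sum_measureReal_preimage_mul_comp (μ := μ) hXY Prod.snd
    fun t => -Real.log (μ.real (Y ⁻¹' {t}))
  rw [entH_eq_sum_mul_neg_log X, entH_eq_sum_mul_neg_log Y]
  refine Eq.trans ?_ (congrArg₂ (· + ·) h₁ h₂)
  rw [← Finset.sum_add_distrib]
  refine Finset.sum_congr rfl fun z _ => ?_
  rcases eq_or_ne (μ.real ((fun ω => (X ω, Y ω)) ⁻¹' {z})) 0 with h | h
  · simp [h]
  · have hx : μ.real (X ⁻¹' {z.1}) ≠ 0 := fun h0 => h <|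
      measureReal_mono_null (fun ω hω => congrArg Prod.fst hω) h0
    have hy : μ.real (Y ⁻¹' {z.2}) ≠ 0 := fun h0 => h <|
      measureReal_mono_null (fun ω hω => congrArg Prod.snd hω) h0
    rw [Real.log_mul hx hy]
    ring

lemma entH_prodMk_le_add [IsProbabilityMeasure μ] (hX : Measurable X) (hY : Measurable Y) :
    entH μ (fun ω => (X ω, Y ω)) ≤ entH μ X + entH μ Y := by
  rw [← sum_prod_mul_neg_log hX hY]
  refine entH_le_sum_mul_neg_log (hX.prodMk hY) _
    (fun z => mul_nonneg measureReal_nonneg measureReal_nonneg) ?_ fun z hz => ?_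
  · rw [Fintype.sum_prod_type]
    simp [← Finset.mul_sum, sum_measureReal_preimage hX, sum_measureReal_preimage hY]
  · rcases mul_eq_zero.1 hz with h | h
    · exact measureReal_mono_null (fun ω hω => congrArg Prod.fst hω) h
    · exact measureReal_mono_null (fun ω hω => congrArg Prod.snd hω) h

lemma entH_prodMk_eq_add [IsProbabilityMeasure μ] (hX : Measurable X) (hY : Measurable Y)
    (hXY : ∀ s t, μ ((fun ω => (X ω, Y ω)) ⁻¹' {(s, t)}) = μ (X ⁻¹' {s}) * μ (Y ⁻¹' {t})) :
    entH μ (fun ω => (X ω, Y ω)) = entH μ X + entH μ Y := by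
  rw [← sum_prod_mul_neg_log hX hY, entH_eq_sum_mul_neg_log]
  refine Finset.sum_congr rfl fun z _ => ?_
  have h : μ.real ((fun ω => (X ω, Y ω)) ⁻¹' {z}) =
      μ.real (X ⁻¹' {z.1}) * μ.real (Y ⁻¹' {z.2}) := by
    simp only [Measure.real, ← ENNReal.toReal_mul, ← hXY]
  rw [← h]

end Pair

section Family

variable {ι : Type*} [Fintype ι] [DecidableEq ι] {X : ι → Ω → S}

lemma sum_pi_mul_neg_log [IsProbabilityMeasure μ] (hX : ∀ i, Measurable (X i)) :
    ∑ x : ι → S, μ.real ((fun ω i => X i ω) ⁻¹' {x}) *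
      -Real.log (∏ i, μ.real (X i ⁻¹' {x i})) = ∑ i, entH μ (X i) := by
  have hXm : Measurable fun ω i => X i ω := measurable_pi_lambda _ hX
  have h := fun i => sum_measureReal_preimage_mul_comp (μ := μ) hXm (fun x => x i)
    fun s => -Real.log (μ.real (X i ⁻¹' {s}))
  simp only [entH_eq_sum_mul_neg_log]
  refine Eq.trans ?_ (Finset.sum_congr rfl fun i _ => h i)
  rw [Finset.sum_comm]
  refine Finset.sum_congr rfl fun x _ => ?_
  rcases eq_or_ne (μ.real ((fun ω i => X i ω) ⁻¹' {x})) 0 with h0 | h0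
  · simp [h0]
  · have hx : ∀ i ∈ Finset.univ, μ.real (X i ⁻¹' {x i}) ≠ 0 := fun i _ hi => h0 <|
      measureReal_mono_null (fun ω hω => congrFun hω i) hi
    rw [Real.log_prod hx, ← Finset.mul_sum, Finset.sum_neg_distrib]

lemma entH_pi_le_sum [IsProbabilityMeasure μ] (hX : ∀ i, Measurable (X i)) :
    entH μ (fun ω i => X i ω) ≤ ∑ i, entH μ (X i) := by
  rw [← sum_pi_mul_neg_log hX]
  refine entH_le_sum_mul_neg_log (measurable_pi_lambda _ hX) _
    (fun x => Finset.prod_nonneg fun i _ => measureReal_nonneg) ?_ fun x hx => ?_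
  · rw [← Fintype.prod_sum fun i s => μ.real (X i ⁻¹' {s})]
    simp [sum_measureReal_preimage (hX _)]
  · obtain ⟨i, -, hi⟩ := Finset.prod_eq_zero_iff.1 hx
    exact measureReal_mono_null (fun ω hω => congrFun hω i) hi

lemma entH_pi_eq_sum [IsProbabilityMeasure μ] (hX : ∀ i, Measurable (X i))
    (hind : ∀ x : ι → S, μ ((fun ω i => X i ω) ⁻¹' {x}) = ∏ i, μ (X i ⁻¹' {x i})) :
    entH μ (fun ω i => X i ω) = ∑ i, entH μ (X i) := by
  rw [← sum_pi_mul_neg_log hX, entH_eq_sum_mul_neg_log]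
  refine Finset.sum_congr rfl fun x _ => ?_
  have h : μ.real ((fun ω i => X i ω) ⁻¹' {x}) = ∏ i, μ.real (X i ⁻¹' {x i}) := by
    simp only [Measure.real, hind, ENNReal.toReal_prod]
  rw [← h]

end Family

end EntropyInequalities

/-- **Interference lower bound (Lemma 1).** Assume `K ≥ M + 2`. Under the scheme hypotheses
(independence, answer determinism, privacy, ε-reliability), the download cost
`D = ∑ₙ H(Aₙ^[M+1])` satisfies
`D − ℓ + 2ε ≥ I(W_{M+2},…,W_K ; Q₁^[M+1],…,Q_N^[M+1], A₁^[M+1],…,A_N^[M+1] | W₁,…,W_{M+1})`.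
(Messages are 0-indexed: `W i` for `i : Fin K` is the paper's `W_{i+1}`, the cached side
information is `W₁,…,W_M`, and the paper's desired index `M+1` is `⟨M, _⟩ : Fin K`.) -/
theorem interference_lower_bound
    (N K M : ℕ) (hN : 2 ≤ N) (hK : 2 ≤ K) (hKM : M + 2 ≤ K)
    {Ω : Type*} [MeasurableSpace Ω] (μ : Measure Ω)
    {S T U : Type*} [Fintype S] [Fintype T] [Fintype U]
    [MeasurableSpace S] [MeasurableSpace T] [MeasurableSpace U]
    [MeasurableSingletonClass S] [MeasurableSingletonClass T] [MeasurableSingletonClass U]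
    (W : Fin K → Ω → S) (Q : Fin K → Fin N → Ω → T) (A : Fin K → Fin N → Ω → U)
    (ℓ ε : ℝ) (hℓ : 0 < ℓ) (hε : 0 ≤ ε)
    (hScheme : SchemeHyps N K M μ W Q A ℓ ε) :
    (∑ n : Fin N, entH μ (A ⟨M, by omega⟩ n)) - ℓ + 2 * ε ≥
      condMI μ
        (fun ω => fun i : {i : Fin K // M + 1 ≤ (i : ℕ)} => W i.1 ω)
        (fun ω => ((fun n => Q ⟨M, by omega⟩ n ω), (fun n => A ⟨M, by omega⟩ n ω)))
        (fun ω => fun i : {i : Fin K // (i : ℕ) ≤ M} => W i.1 ω) := by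
  obtain ⟨hμ, hW, hQ, hA, hH, hWind, hQW, -, -, hrel⟩ := hScheme
  set k : Fin K := ⟨M, by omega⟩ with hk
  have hkM : M ≤ (k : ℕ) := le_rfl
  let q : Ω → Fin N → T := fun ω n => Q k n ω
  let a : Ω → Fin N → U := fun ω n => A k n ω
  let w : Ω → Fin K → S := fun ω i => W i ω
  let cached : Ω → {i : Fin K // (i : ℕ) < M} → S := fun ω i => W i.1 ω
  let known : Ω → {i : Fin K // (i : ℕ) ≤ M} → S := fun ω i => W i.1 ω
  let rest : Ω → {i : Fin K // M + 1 ≤ (i : ℕ)} → S := fun ω i => W i.1 ω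
  have hq : Measurable q := measurable_pi_lambda _ (hQ k)
  have ha : Measurable a := measurable_pi_lambda _ (hA k)
  have hw : Measurable w := measurable_pi_lambda _ hW
  have hcached : Measurable cached := measurable_pi_lambda _ fun i => hW i.1
  have hknown : Measurable known := measurable_pi_lambda _ fun i => hW i.1
  have hrest : Measurable rest := measurable_pi_lambda _ fun i => hW i.1
  -- `glue` recovers all messages from `known` and `rest`.
  let glue : ({i : Fin K // M + 1 ≤ (i : ℕ)} → S) → ({i : Fin K // (i : ℕ) ≤ M} → S) →
      Fin K → S := fun r d i => if h : (i : ℕ) ≤ M then d ⟨i, h⟩ else r ⟨i, by omega⟩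
  have hglue : ∀ ω, glue (rest ω) (known ω) = w ω := fun ω => by
    funext i
    by_cases h : (i : ℕ) ≤ M <;> simp [glue, h, rest, known, w]
  have hwEnt : entH μ w = ∑ i, entH μ (W i) := entH_pi_eq_sum hW fun x => by
    have h : (fun ω i => W i ω) ⁻¹' {x} = {ω | ∀ i, W i ω = x i} := by
      ext ω; simp [funext_iff]
    rw [h, hWind]
    rfl
  have hqw : entH μ (fun ω => (q ω, w ω)) = entH μ q + entH μ w :=
    entH_prodMk_eq_add hq hw fun s t => by
      have h₁ : (fun ω => (q ω, w ω)) ⁻¹' {(s, t)} =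
          {ω | (∀ n, Q k n ω = s n) ∧ ∀ i, W i ω = t i} := by
        ext ω; simp [q, w, funext_iff]
      have h₂ : q ⁻¹' {s} = {ω | ∀ n, Q k n ω = s n} := by
        ext ω; simp [q, funext_iff]
      have h₃ : w ⁻¹' {t} = {ω | ∀ i, W i ω = t i} := by
        ext ω; simp [w, funext_iff]
      rw [h₁, h₂, h₃, hQW k hkM]
  have hw_le : entH μ w ≤ entH μ rest + entH μ known :=
    (entH_le_of_eq_comp (hrest.prodMk hknown) (fun z => glue z.1 z.2)
      fun ω => (hglue ω).symm).trans (entH_prodMk_le_add hrest hknown)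
  have hrest_le : entH μ rest ≤ ((K - (M + 1) : ℕ) : ℝ) * ℓ := by
    refine (entH_pi_le_sum fun i : {i : Fin K // M + 1 ≤ (i : ℕ)} => hW i.1).trans_eq ?_
    have hcard : Fintype.card {i : Fin K // M + 1 ≤ (i : ℕ)} = K - (M + 1) := by
      have h := Fintype.card_subtype_compl fun i : Fin K => (i : ℕ) < M + 1
      simp only [not_lt] at h
      rw [h, Fintype.card_fin, Fintype.card_subtype, Fin.card_filter_val_lt,
        min_eq_right (by omega)]
    rw [← hcard]
    simp [hH]
  have hcached_le : entH μ cached ≤ (M : ℝ) * ℓ := by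
    refine (entH_pi_le_sum fun i : {i : Fin K // (i : ℕ) < M} => hW i.1).trans_eq ?_
    have hcard : Fintype.card {i : Fin K // (i : ℕ) < M} = M := by
      rw [Fintype.card_subtype, Fin.card_filter_val_lt, min_eq_right (by omega)]
    rw [Finset.sum_congr rfl fun i _ => hH i.1]
    simp [hcard]
  have hknown_ge : entH μ cached + ℓ ≤ entH μ known := by
    rw [Nat.cast_sub (by omega)] at hrest_le
    simp only [hH, Finset.sum_const, Finset.card_univ, Fintype.card_fin, nsmul_eq_mul] at hwEnt
    push_cast at hrest_le
    linarith
  have hrestKnown : entH μ (fun ω => (rest ω, known ω)) ≤ entH μ w :=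
    entH_le_of_eq_comp hw (fun x => (fun i => x i.1, fun i => x i.1)) fun _ => rfl
  have hall : entH μ (fun ω => (q ω, w ω)) ≤
      entH μ (fun ω => ((rest ω, (q ω, a ω)), known ω)) :=
    entH_le_of_eq_comp ((hrest.prodMk (hq.prodMk ha)).prodMk hknown)
      (fun z => (z.1.2.1, glue z.1.1 z.2)) fun ω => congrArg (Prod.mk (q ω)) (hglue ω).symm
  have hdec : entH μ (fun ω => ((q ω, a ω), known ω)) ≤
      entH μ (fun ω => (W k ω, (q ω, a ω, cached ω))) := by
    refine entH_le_of_eq_comp ((hW k).prodMk (hq.prodMk (ha.prodMk hcached)))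
      (fun z => ((z.2.1, z.2.2.1), fun i : {i : Fin K // (i : ℕ) ≤ M} =>
        if h : (i.1 : ℕ) < M then z.2.2.2 ⟨i.1, h⟩ else z.1)) fun ω => ?_
    refine Prod.ext rfl (funext fun i => ?_)
    by_cases h : (i.1 : ℕ) < M
    · simp [h, known, cached]
    · have hi : i.1 = k := Fin.ext (le_antisymm i.2 (not_lt.1 h))
      simp [known, hi, hk]
  have hans : entH μ (fun ω => (q ω, a ω, cached ω)) ≤
      entH μ q + entH μ cached + ∑ n, entH μ (A k n) := by
    have h₁ := entH_prodMk_le_add (μ := μ) hq (ha.prodMk hcached)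
    have h₂ := entH_prodMk_le_add (μ := μ) ha hcached
    have h₃ : entH μ a ≤ ∑ n, entH μ (A k n) := entH_pi_le_sum (hA k)
    linarith
  have hrel' : entH μ (fun ω => (W k ω, (q ω, a ω, cached ω))) -
      entH μ (fun ω => (q ω, a ω, cached ω)) ≤ ε := hrel k hkM
  change (entH μ (fun ω => (rest ω, known ω)) - entH μ known +
      (entH μ (fun ω => ((q ω, a ω), known ω)) - entH μ known) -
      (entH μ (fun ω => ((rest ω, (q ω, a ω)), known ω)) - entH μ known)) ≤
    (∑ n, entH μ (A k n)) - ℓ + 2 * ε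
  linarith
end

section
/- Induction lemma (Lemma 2): Under the scheme hypotheses (independence, answer determinism, privacy, ε-reliability), for every k ∈ {M+2, …, K} one has I(W_k, …, W_K ; Q_1^[k−1], …, Q_N^[k−1], A_1^[k−1], …, A_N^[k−1] | W_1, …, W_{k−1}) ≥ (1/N) · I(W_{k+1}, …, W_K ; Q_1^[k], …, Q_N^[k], A_1^[k], …, A_N^[k] | W_1, …, W_k) + (ℓ − ε)/N, where for k = K the conditional mutual information term on the right-hand side is taken to be 0. -/
open MeasureTheory

section Entropy

open ProbabilityTheory

variable {Ω : Type*} [MeasurableSpace Ω] {μ : Measure Ω}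

theorem entH_eq_map {S : Type*} [Fintype S] [MeasurableSpace S] [MeasurableSingletonClass S]
    {X : Ω → S} (hX : Measurable X) :
    entH μ X = ∑ s : S, Real.negMulLog ((μ.map X).real {s}) := by
  unfold entH
  refine Finset.sum_congr rfl fun s _ => ?_
  rw [measureReal_def, Measure.map_apply hX (measurableSet_singleton s)]

/-- Relabelling a random variable injectively preserves its entropy. -/
theorem entH_comp_injective {S T : Type*} [Fintype S] [Fintype T] (Y : Ω → S) {f : S → T}
    (hf : f.Injective) : entH μ (fun ω => f (Y ω)) = entH μ Y := by
  symm
  refine Fintype.sum_of_injective f hf _ _ (fun t ht => ?_) (fun s => ?_)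
  · have : (fun ω => f (Y ω)) ⁻¹' {t} = ∅ := by
      ext ω
      simp only [Set.mem_preimage, Set.mem_singleton_iff, Set.mem_empty_iff_false, iff_false]
      rintro rfl
      exact ht ⟨_, rfl⟩
    simp [this]
  · congr 3
    ext ω
    simp [hf.eq_iff]

theorem entH_comp_eq_of_map_eq {S T : Type*} [Fintype S] [Fintype T]
    [MeasurableSpace S] [MeasurableSingletonClass S] [MeasurableSpace T]
    [MeasurableSingletonClass T] {X Y : Ω → S} (hX : Measurable X) (hY : Measurable Y)
    (h : μ.map X = μ.map Y) (f : S → T) :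
    entH μ (fun ω => f (X ω)) = entH μ (fun ω => f (Y ω)) := by
  have hf : Measurable f := measurable_of_finite f
  have : μ.map (fun ω => f (X ω)) = μ.map (fun ω => f (Y ω)) := by
    rw [← Function.comp_def, ← Function.comp_def, ← Measure.map_map hf hX,
      ← Measure.map_map hf hY, h]
  have hfX : Measurable fun ω => f (X ω) := hf.comp hX
  have hfY : Measurable fun ω => f (Y ω) := hf.comp hY
  rw [entH_eq_map hfX, entH_eq_map hfY, this]

theorem sum_measure_pair_preimage [IsFiniteMeasure μ] {S T : Type*} [Fintype S] [Fintype T]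
    [MeasurableSpace S] [MeasurableSingletonClass S]
    [MeasurableSpace T] [MeasurableSingletonClass T]
    {X : Ω → S} {Y : Ω → T} (hX : Measurable X) (hY : Measurable Y) (t : T) :
    ∑ s, (μ (((fun ω => (X ω, Y ω))) ⁻¹' {(s, t)})).toReal = (μ (Y ⁻¹' {t})).toReal := by
  have hu : Y ⁻¹' {t} = ⋃ s ∈ (Finset.univ : Finset S), (fun ω => (X ω, Y ω)) ⁻¹' {(s, t)} := by
    ext ω; simp
  rw [hu, ← measureReal_def, measureReal_biUnion_finset]
  · rfl
  · intro a _ b _ hab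
    refine Set.disjoint_left.mpr fun ω h1 h2 => hab ?_
    simp only [Set.mem_preimage, Set.mem_singleton_iff, Prod.mk.injEq] at h1 h2
    rw [← h1.1, ← h2.1]
  · intro s _
    exact (hX.prodMk hY) (measurableSet_singleton _)

/-- Entropy does not decrease when a further random variable is observed. -/
theorem entH_le_entH_pair [IsFiniteMeasure μ] {S T : Type*} [Fintype S] [Fintype T]
    [MeasurableSpace S] [MeasurableSingletonClass S]
    [MeasurableSpace T] [MeasurableSingletonClass T]
    {X : Ω → S} {Y : Ω → T} (hX : Measurable X) (hY : Measurable Y) :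
    entH μ Y ≤ entH μ (fun ω => (X ω, Y ω)) := by
  unfold entH
  rw [Fintype.sum_prod_type_right]
  refine Finset.sum_le_sum fun t _ => ?_
  rw [← sum_measure_pair_preimage hX hY t]
  set p : S → ℝ := fun s => (μ ((fun ω => (X ω, Y ω)) ⁻¹' {(s, t)})).toReal
  have hp : ∀ s, 0 ≤ p s := fun s => ENNReal.toReal_nonneg
  change Real.negMulLog (∑ s, p s) ≤ ∑ s, Real.negMulLog (p s)
  simp only [Real.negMulLog]
  rw [neg_mul, Finset.sum_mul, ← Finset.sum_neg_distrib]
  refine Finset.sum_le_sum fun s _ => ?_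
  rcases (hp s).eq_or_lt with h | h
  · simp [← h]
  · have : p s ≤ ∑ s, p s := Finset.single_le_sum (fun i _ => hp i) (Finset.mem_univ s)
    have := mul_le_mul_of_nonneg_left (Real.log_le_log h this) (hp s)
    linarith

theorem sum_negMulLog_submodular {S T U : Type*} [Fintype S] [Fintype T] [Fintype U]
    (p : S → T → U → ℝ) (hp : ∀ s t u, 0 ≤ p s t u) :
    ∑ s, ∑ t, ∑ u, Real.negMulLog (p s t u) + ∑ u, Real.negMulLog (∑ s, ∑ t, p s t u) ≤
      ∑ s, ∑ u, Real.negMulLog (∑ t, p s t u) + ∑ t, ∑ u, Real.negMulLog (∑ s, p s t u) := by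
  set a : S → U → ℝ := fun s u => ∑ t, p s t u with ha
  set b : T → U → ℝ := fun t u => ∑ s, p s t u with hb
  set c : U → ℝ := fun u => ∑ s, ∑ t, p s t u with hc
  have ha0 : ∀ s u, 0 ≤ a s u := fun s u => Finset.sum_nonneg fun t _ => hp s t u
  have hb0 : ∀ t u, 0 ≤ b t u := fun t u => Finset.sum_nonneg fun s _ => hp s t u
  have hc0 : ∀ u, 0 ≤ c u := fun u => Finset.sum_nonneg fun s _ => ha0 s u
  have hca : ∀ u, ∑ s, a s u = c u := fun u => rfl
  have hcb : ∀ u, ∑ t, b t u = c u := fun u => Finset.sum_comm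
  have pa : ∀ s t u, p s t u ≤ a s u := fun s t u =>
    Finset.single_le_sum (f := fun t => p s t u) (fun t _ => hp s t u) (Finset.mem_univ t)
  have pb : ∀ s t u, p s t u ≤ b t u := fun s t u =>
    Finset.single_le_sum (f := fun s => p s t u) (fun s _ => hp s t u) (Finset.mem_univ s)
  have ac : ∀ s u, a s u ≤ c u := fun s u =>
    Finset.single_le_sum (f := fun s => a s u) (fun s _ => ha0 s u) (Finset.mem_univ s)
  have key : ∀ s t u, p s t u * (Real.log (a s u) + Real.log (b t u) - Real.log (p s t u)
      - Real.log (c u)) ≤ a s u * b t u / c u - p s t u := by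
    intro s t u
    rcases (hp s t u).eq_or_lt with h | h
    · rw [← h]
      simpa using div_nonneg (mul_nonneg (ha0 s u) (hb0 t u)) (hc0 u)
    · have h1 : 0 < a s u := h.trans_le (pa s t u)
      have h2 : 0 < b t u := h.trans_le (pb s t u)
      have h3 : 0 < c u := h1.trans_le (ac s u)
      have hl := Real.log_le_sub_one_of_pos (x := a s u * b t u / (p s t u * c u)) (by positivity)
      rw [Real.log_div (by positivity) (by positivity), Real.log_mul h1.ne' h2.ne',
        Real.log_mul h.ne' h3.ne'] at hl
      have := mul_le_mul_of_nonneg_left hl h.le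
      have e : p s t u * (a s u * b t u / (p s t u * c u) - 1) = a s u * b t u / c u - p s t u := by
        field_simp
      rw [e] at this
      linarith
  have hsum := Finset.sum_le_sum fun u (_ : u ∈ Finset.univ) =>
    Finset.sum_le_sum fun s (_ : s ∈ Finset.univ) =>
      Finset.sum_le_sum fun t (_ : t ∈ Finset.univ) => key s t u
  have hr : ∀ u, ∑ s, ∑ t, (a s u * b t u / c u - p s t u) = 0 := by
    intro u
    simp only [Finset.sum_sub_distrib]
    have : ∑ s, ∑ t, a s u * b t u / c u = c u := by
      simp_rw [← Finset.sum_div, ← Finset.mul_sum, hcb, ← Finset.sum_mul, hca]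
      exact mul_self_div_self (c u)
    rw [this]
    exact sub_self _
  simp_rw [hr, mul_sub, mul_add, Finset.sum_sub_distrib, Finset.sum_add_distrib] at hsum
  have e1 : ∑ s, ∑ t, ∑ u, Real.negMulLog (p s t u) =
      - ∑ u, ∑ s, ∑ t, p s t u * Real.log (p s t u) := by
    simp only [Real.negMulLog, neg_mul, Finset.sum_neg_distrib]
    rw [Finset.sum_comm_cycle]
  have e2 : ∑ u, Real.negMulLog (c u) = - ∑ u, ∑ s, ∑ t, p s t u * Real.log (c u) := by
    simp only [Real.negMulLog, neg_mul, Finset.sum_neg_distrib, ← Finset.sum_mul, hc]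
  have e3 : ∑ s, ∑ u, Real.negMulLog (a s u) =
      - ∑ u, ∑ s, ∑ t, p s t u * Real.log (a s u) := by
    simp only [Real.negMulLog, neg_mul, Finset.sum_neg_distrib, ← Finset.sum_mul, ha]
    rw [Finset.sum_comm]
  have e4 : ∑ t, ∑ u, Real.negMulLog (b t u) =
      - ∑ u, ∑ s, ∑ t, p s t u * Real.log (b t u) := by
    simp only [Real.negMulLog, neg_mul, Finset.sum_neg_distrib]
    rw [Finset.sum_comm]
    congr 1
    refine Finset.sum_congr rfl fun u _ => ?_
    rw [Finset.sum_comm]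
    simp only [← Finset.sum_mul, hb]
  rw [Finset.sum_const_zero] at hsum
  rw [e1, e2, e3, e4]
  linarith

/-- Strong subadditivity of Shannon entropy. -/
theorem entH_submodular [IsFiniteMeasure μ] {S T U : Type*} [Fintype S] [Fintype T] [Fintype U]
    [MeasurableSpace S] [MeasurableSingletonClass S]
    [MeasurableSpace T] [MeasurableSingletonClass T]
    [MeasurableSpace U] [MeasurableSingletonClass U]
    {X : Ω → S} {Y : Ω → T} {Z : Ω → U} (hX : Measurable X) (hY : Measurable Y)
    (hZ : Measurable Z) :
    entH μ (fun ω => (X ω, Y ω, Z ω)) + entH μ Z ≤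
      entH μ (fun ω => (X ω, Z ω)) + entH μ (fun ω => (Y ω, Z ω)) := by
  have h := sum_negMulLog_submodular
    (fun s t u => (μ ((fun ω => (X ω, Y ω, Z ω)) ⁻¹' {(s, t, u)})).toReal)
    (fun _ _ _ => ENNReal.toReal_nonneg)
  have h1 : ∀ t u, ∑ s, (μ ((fun ω => (X ω, Y ω, Z ω)) ⁻¹' {(s, t, u)})).toReal =
      (μ ((fun ω => (Y ω, Z ω)) ⁻¹' {(t, u)})).toReal := fun t u =>
    sum_measure_pair_preimage hX (hY.prodMk hZ) (t, u)
  have h2 : ∀ s u, ∑ t, (μ ((fun ω => (X ω, Y ω, Z ω)) ⁻¹' {(s, t, u)})).toReal =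
      (μ ((fun ω => (X ω, Z ω)) ⁻¹' {(s, u)})).toReal := fun s u => by
    rw [← sum_measure_pair_preimage hY (hX.prodMk hZ) (s, u)]
    refine Finset.sum_congr rfl fun t _ => ?_
    congr 2
    ext ω
    simp only [Set.mem_preimage, Set.mem_singleton_iff, Prod.mk.injEq]
    tauto
  have h3 : ∀ u, ∑ s, (μ ((fun ω => (X ω, Z ω)) ⁻¹' {(s, u)})).toReal =
      (μ (Z ⁻¹' {u})).toReal := fun u => sum_measure_pair_preimage hX hZ u
  simp only [h1, h2, h3] at h
  simpa only [entH, Fintype.sum_prod_type] using h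

/-- Conditioning on a function of `Z` leaves at least as much uncertainty as conditioning on `Z`. -/
theorem condH_le_condH_comp [IsFiniteMeasure μ] {S T U : Type*}
    [Fintype S] [Fintype T] [Fintype U]
    [MeasurableSpace S] [MeasurableSingletonClass S]
    [MeasurableSpace T] [MeasurableSingletonClass T]
    [MeasurableSpace U] [MeasurableSingletonClass U]
    {X : Ω → S} {Z : Ω → T} (hX : Measurable X) (hZ : Measurable Z) (f : T → U) :
    condH μ X Z ≤ condH μ X (fun ω => f (Z ω)) := by
  have hf : Measurable f := measurable_of_finite f
  have h := entH_submodular (μ := μ) hX hZ (hf.comp hZ)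
  have h1 := entH_comp_injective (μ := μ) (fun ω => (X ω, Z ω))
    (f := fun p : S × T => (p.1, p.2, f p.2)) (by
      rintro ⟨_, _⟩ ⟨_, _⟩ h; simp only [Prod.mk.injEq] at h ⊢; tauto)
  have h2 := entH_comp_injective (μ := μ) Z
    (f := fun p : T => (p, f p)) (by
      rintro _ _ h; simp only [Prod.mk.injEq] at h; exact h.1)
  simp only [Function.comp_def] at h
  unfold condH
  linarith

theorem condMI_eq_condH_sub {S T U : Type*} [Fintype S] [Fintype T] [Fintype U]
    (X : Ω → S) (Y : Ω → T) (Z : Ω → U) :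
    condMI μ X Y Z = condH μ X Z - condH μ X (fun ω => (Y ω, Z ω)) := by
  have h := entH_comp_injective (μ := μ) (fun ω => (X ω, Y ω, Z ω))
    (f := fun p : S × T × U => ((p.1, p.2.1), p.2.2)) (by
      rintro ⟨_, _, _⟩ ⟨_, _, _⟩ h; simp only [Prod.mk.injEq] at h ⊢; tauto)
  unfold condMI condH
  simp only at h
  rw [h]
  ring

theorem entH_pair_of_indepFun [IsProbabilityMeasure μ] {S T : Type*} [Fintype S] [Fintype T]
    [MeasurableSpace S] [MeasurableSingletonClass S]
    [MeasurableSpace T] [MeasurableSingletonClass T]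
    {X : Ω → S} {Y : Ω → T} (hX : Measurable X) (hY : Measurable Y) (h : IndepFun X Y μ) :
    entH μ (fun ω => (X ω, Y ω)) = entH μ X + entH μ Y := by
  have hm := (indepFun_iff_map_prod_eq_prod_map_map hX.aemeasurable hY.aemeasurable).1 h
  have := Measure.isProbabilityMeasure_map (μ := μ) hX.aemeasurable
  have := Measure.isProbabilityMeasure_map (μ := μ) hY.aemeasurable
  rw [entH_eq_map (hX.prodMk hY), entH_eq_map hX, entH_eq_map hY, hm, Fintype.sum_prod_type]
  have e : ∀ s t, ((μ.map X).prod (μ.map Y)).real {(s, t)} =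
      (μ.map X).real {s} * (μ.map Y).real {t} := fun s t => by
    rw [← Set.singleton_prod_singleton, measureReal_prod_prod]
  simp only [e, Real.negMulLog_mul, Finset.sum_add_distrib, ← Finset.sum_mul, ← Finset.mul_sum]
  rw [sum_measureReal_singleton, sum_measureReal_singleton, Finset.coe_univ, Finset.coe_univ,
    probReal_univ, probReal_univ]
  ring

/-- Conditional subadditivity of Shannon entropy for a finite family. -/
theorem condH_pi_le_sum [IsFiniteMeasure μ] {U Z : Type*} [Fintype U] [Fintype Z]
    [MeasurableSpace U] [MeasurableSingletonClass U]
    [MeasurableSpace Z] [MeasurableSingletonClass Z]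
    {Y : Ω → Z} (hY : Measurable Y) {n : ℕ} (A : Fin n → Ω → U) (hA : ∀ i, Measurable (A i)) :
    condH μ (fun ω i => A i ω) Y ≤ ∑ i, condH μ (A i) Y := by
  induction n with
  | zero =>
    have h := entH_comp_injective (μ := μ) Y
      (f := fun y : Z => ((fun i : Fin 0 => i.elim0 : Fin 0 → U), y)) (by
        rintro _ _ h; simpa using h)
    have e : (fun ω => ((fun i : Fin 0 => A i ω), Y ω)) =
        fun ω => ((fun i : Fin 0 => i.elim0 : Fin 0 → U), Y ω) := by
      funext ω
      exact Prod.ext (Subsingleton.elim _ _) rfl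
    simp only [condH, Finset.univ_eq_empty, Finset.sum_empty, e, h, sub_self, le_refl]
  | succ n ih =>
    have hi := ih (fun i => A i.succ) (fun i => hA _)
    have hs := entH_submodular (μ := μ) (hA 0)
      (measurable_pi_lambda (fun ω (i : Fin n) => A i.succ ω) fun i => hA i.succ) hY
    have h := entH_comp_injective (μ := μ) (fun ω => (A 0 ω, (fun i : Fin n => A i.succ ω), Y ω))
      (f := fun p : U × (Fin n → U) × Z => ((Fin.cons p.1 p.2.1 : Fin (n + 1) → U), p.2.2)) (by
        rintro ⟨_, _, _⟩ ⟨_, _, _⟩ h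
        simp only [Prod.mk.injEq, Fin.cons_inj] at h ⊢
        tauto)
    have e : (fun ω => ((fun i => A i ω), Y ω)) = fun ω =>
        ((Fin.cons (A 0 ω) (fun i : Fin n => A i.succ ω) : Fin (n + 1) → U), Y ω) := by
      funext ω
      refine Prod.ext (funext fun i => ?_) rfl
      refine Fin.cases ?_ (fun j => ?_) i <;> simp
    rw [Fin.sum_univ_succ]
    unfold condH at hi ⊢
    rw [e]
    simp only at h
    linarith

end Entropy

/-- **Induction lemma (Lemma 2).** Under the scheme hypotheses (independence, answer
determinism, privacy, ε-reliability), for every `k ∈ {M+2, …, K}` (paper's 1-indexing),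
`I(W_k,…,W_K ; Q₁^[k−1],…,A_N^[k−1] | W₁,…,W_{k−1})
  ≥ (1/N)·I(W_{k+1},…,W_K ; Q₁^[k],…,A_N^[k] | W₁,…,W_k) + (ℓ − ε)/N`.
(Messages are 0-indexed: `W i` for `i : Fin K` is the paper's `W_{i+1}`; the paper's desired
indices `k−1` and `k` are `⟨k−2, _⟩` and `⟨k−1, _⟩ : Fin K`. For `k = K` the subtype
`{i // k ≤ i}` is empty, so the right-hand conditional mutual information term is the
mutual information of a constant and equals `0`, as stipulated.) -/
theorem induction_lemma
    (N K M : ℕ) (hN : 2 ≤ N) (hK : 2 ≤ K) (hMK : M < K)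
    {Ω : Type*} [MeasurableSpace Ω] (μ : Measure Ω)
    {S T U : Type*} [Fintype S] [Fintype T] [Fintype U]
    [MeasurableSpace S] [MeasurableSpace T] [MeasurableSpace U]
    [MeasurableSingletonClass S] [MeasurableSingletonClass T] [MeasurableSingletonClass U]
    (W : Fin K → Ω → S) (Q : Fin K → Fin N → Ω → T) (A : Fin K → Fin N → Ω → U)
    (ℓ ε : ℝ) (hℓ : 0 < ℓ) (hε : 0 ≤ ε)
    (hScheme : SchemeHyps N K M μ W Q A ℓ ε) :
    ∀ (k : ℕ) (hk1 : M + 2 ≤ k) (hk2 : k ≤ K),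
      condMI μ
        (fun ω => fun i : {i : Fin K // k ≤ (i : ℕ) + 1} => W i.1 ω)
        (fun ω => ((fun n => Q ⟨k - 2, by omega⟩ n ω), (fun n => A ⟨k - 2, by omega⟩ n ω)))
        (fun ω => fun i : {i : Fin K // (i : ℕ) + 1 < k} => W i.1 ω)
      ≥ (1 / (N : ℝ)) *
          condMI μ
            (fun ω => fun i : {i : Fin K // k ≤ (i : ℕ)} => W i.1 ω)
            (fun ω => ((fun n => Q ⟨k - 1, by omega⟩ n ω), (fun n => A ⟨k - 1, by omega⟩ n ω)))
            (fun ω => fun i : {i : Fin K // (i : ℕ) < k} => W i.1 ω)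
        + (ℓ - ε) / (N : ℝ) := by
  obtain ⟨hμ, hWm, hQm, hAm, hWℓ, hWind, hQW, hdet, hpriv, hrel⟩ := hScheme
  intro k hk1 hk2
  set a : Fin K := ⟨k - 2, by omega⟩ with ha
  set b : Fin K := ⟨k - 1, by omega⟩ with hb
  have hMa : M ≤ (a : ℕ) := by simp only [ha]; omega
  have hMb : M ≤ (b : ℕ) := by simp only [hb]; omega
  have hbv : (b : ℕ) = k - 1 := rfl
  set F : Ω → Fin K → S := fun ω i => W i ω with hF
  have hFm : Measurable F := measurable_pi_lambda _ hWm
  set V : Ω → {i : Fin K // (i : ℕ) + 1 < k} → S := fun ω i => W i.1 ω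
  have hVm : Measurable V := measurable_pi_lambda _ fun i => hWm _
  set V' : Ω → {i : Fin K // (i : ℕ) < k} → S := fun ω i => W i.1 ω
  set X : Ω → {i : Fin K // k ≤ (i : ℕ) + 1} → S := fun ω i => W i.1 ω
  have hXm : Measurable X := measurable_pi_lambda _ fun i => hWm _
  set X' : Ω → {i : Fin K // k ≤ (i : ℕ)} → S := fun ω i => W i.1 ω
  set q : Ω → Fin N → T := fun ω n => Q b n ω with hq
  have hqm : Measurable q := measurable_pi_lambda _ fun n => hQm b n
  set R : Ω → Fin N → U := fun ω n => A b n ω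
  have hRm : Measurable R := measurable_pi_lambda _ fun n => hAm b n
  -- restriction of the message tuple to a set of indices
  let res (P : Fin K → Prop) (w : Fin K → S) : {i // P i} → S := fun i => w i.1
  have hIqF : ProbabilityTheory.IndepFun q F μ := by
    rw [ProbabilityTheory.indepFun_iff_map_prod_eq_prod_map_map hqm.aemeasurable hFm.aemeasurable]
    have := Measure.isProbabilityMeasure_map (μ := μ) hqm.aemeasurable
    have := Measure.isProbabilityMeasure_map (μ := μ) hFm.aemeasurable
    refine Measure.ext_of_singleton fun ⟨t, w⟩ => ?_
    rw [Measure.map_apply (hqm.prodMk hFm) (measurableSet_singleton _),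
      ← Set.singleton_prod_singleton, Measure.prod_prod,
      Measure.map_apply hqm (measurableSet_singleton _),
      Measure.map_apply hFm (measurableSet_singleton _)]
    convert hQW b hMb t w using 2
    · ext ω; simp [hq, hF, funext_iff]
    · congr 1; ext ω; simp [hq, funext_iff]
    · congr 1; ext ω; simp [hF, funext_iff]
  have hiW : ProbabilityTheory.iIndepFun W μ := by
    rw [ProbabilityTheory.iIndepFun_iff_map_fun_eq_pi_map fun i => (hWm i).aemeasurable]
    have : ∀ i, IsProbabilityMeasure (μ.map (W i)) := fun i =>
      Measure.isProbabilityMeasure_map (hWm i).aemeasurable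
    refine Measure.ext_of_singleton fun w => ?_
    rw [Measure.map_apply hFm (measurableSet_singleton _), Measure.pi_singleton]
    convert hWind w using 2
    · ext ω; simp [hF, funext_iff]
    · rw [Measure.map_apply (hWm _) (measurableSet_singleton _)]; rfl
  -- entropies of the messages
  have hXV : entH μ (fun ω => (X ω, V ω)) = entH μ F :=
    entH_comp_injective F (f := fun w => (res (fun i => k ≤ (i : ℕ) + 1) w,
      res (fun i => (i : ℕ) + 1 < k) w)) (by
      intro w w' h
      simp only [Prod.mk.injEq, funext_iff, res, Subtype.forall] at h
      funext i
      by_cases hi : (i : ℕ) + 1 < k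
      · exact h.2 i hi
      · exact h.1 i (by omega))
  have hX'V' : entH μ (fun ω => (X' ω, V' ω)) = entH μ F :=
    entH_comp_injective F (f := fun w => (res (fun i => k ≤ (i : ℕ)) w,
      res (fun i => (i : ℕ) < k) w)) (by
      intro w w' h
      simp only [Prod.mk.injEq, funext_iff, res, Subtype.forall] at h
      funext i
      by_cases hi : (i : ℕ) < k
      · exact h.2 i hi
      · exact h.1 i (by omega))
  have hV'V : entH μ (fun ω => (W b ω, V ω)) = entH μ V' :=
    entH_comp_injective V' (f := fun w : {i : Fin K // (i : ℕ) < k} → S =>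
      (w ⟨b, by omega⟩,
        (fun i => w ⟨i.1, by omega⟩ : {i : Fin K // (i : ℕ) + 1 < k} → S))) (by
      intro w w' h
      simp only [Prod.mk.injEq, funext_iff, Subtype.forall] at h
      funext ⟨i, hi⟩
      by_cases hi' : (i : ℕ) + 1 < k
      · exact h.2 i hi'
      · have : i = b := Fin.ext (by omega)
        subst this
        exact h.1)
  have hWV : entH μ V' = ℓ + entH μ V := by
    rw [← hV'V, ← hWℓ b]
    refine entH_pair_of_indepFun (hWm b) hVm ?_
    have h := hiW.indepFun_finset {b} (Finset.univ.filter fun i : Fin K => (i : ℕ) + 1 < k)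
      (Finset.disjoint_left.2 fun i hi hi' => by
        simp only [Finset.mem_singleton, Finset.mem_filter, Finset.mem_univ, true_and] at hi hi'
        subst hi
        omega) hWm
    exact h.comp (φ := fun w => w ⟨b, by simp⟩)
      (ψ := fun w => (fun i => w ⟨i.1, by simpa using i.2⟩ :
        {i : Fin K // (i : ℕ) + 1 < k} → S)) (measurable_of_finite _) (measurable_of_finite _)
  have hqF : entH μ (fun ω => (q ω, F ω)) = entH μ q + entH μ F :=
    entH_pair_of_indepFun hqm hFm hIqF
  have hqV : entH μ (fun ω => (q ω, V ω)) = entH μ q + entH μ V :=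
    entH_pair_of_indepFun hqm hVm
      (hIqF.comp (φ := id) (ψ := res (fun i => (i : ℕ) + 1 < k)) measurable_id
        (measurable_of_finite _))
  -- the contribution of a single database
  have hsingle : ∀ n, condH μ (A b n) (fun ω => (q ω, V ω)) ≤
      condMI μ X (fun ω => ((fun n => Q a n ω), (fun n => A a n ω))) V := by
    intro n
    have hQF : entH μ (fun ω => (Q b n ω, F ω)) = entH μ (Q b n) + entH μ F :=
      entH_pair_of_indepFun (hQm b n) hFm
        (hIqF.comp (φ := fun t : Fin N → T => t n) (ψ := id) (measurable_of_finite _) measurable_id)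
    have hQV : entH μ (fun ω => (Q b n ω, V ω)) = entH μ (Q b n) + entH μ V :=
      entH_pair_of_indepFun (hQm b n) hVm
        (hIqF.comp (φ := fun t : Fin N → T => t n) (ψ := res (fun i => (i : ℕ) + 1 < k))
          (measurable_of_finite _) (measurable_of_finite _))
    have hmap : μ.map (fun ω => (Q a n ω, A a n ω, F ω)) =
        μ.map (fun ω => (Q b n ω, A b n ω, F ω)) := by
      refine Measure.ext_of_singleton fun ⟨t, u, w⟩ => ?_
      rw [Measure.map_apply ((hQm a n).prodMk ((hAm a n).prodMk hFm)) (measurableSet_singleton _),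
        Measure.map_apply ((hQm b n).prodMk ((hAm b n).prodMk hFm)) (measurableSet_singleton _)]
      convert hpriv n a b hMa hMb t u w using 2 <;>
      · ext ω; simp [hF, funext_iff]
    have hp1 := entH_comp_eq_of_map_eq ((hQm a n).prodMk ((hAm a n).prodMk hFm))
      ((hQm b n).prodMk ((hAm b n).prodMk hFm)) hmap
      (fun p => ((p.1, p.2.1), res (fun i => (i : ℕ) + 1 < k) p.2.2))
    have hp2 := entH_comp_eq_of_map_eq ((hQm a n).prodMk ((hAm a n).prodMk hFm))
      ((hQm b n).prodMk ((hAm b n).prodMk hFm)) hmap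
      (fun p => (res (fun i => k ≤ (i : ℕ) + 1) p.2.2, (p.1, p.2.1),
        res (fun i => (i : ℕ) + 1 < k) p.2.2))
    have hdp := condH_le_condH_comp (μ := μ) (Z := fun ω =>
        (((fun n => Q a n ω), (fun n => A a n ω)), V ω)) hXm
      (((measurable_pi_lambda _ fun n => hQm a n).prodMk
        (measurable_pi_lambda _ fun n => hAm a n)).prodMk hVm)
      (fun p => ((p.1.1 n, p.1.2 n), p.2))
    have hcq := condH_le_condH_comp (μ := μ) (hAm b n) (hqm.prodMk hVm)
      (fun p => (p.1 n, p.2))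
    have hj : entH μ (fun ω => (X ω, (Q b n ω, A b n ω), V ω)) =
        entH μ (fun ω => (A b n ω, Q b n ω, F ω)) :=
      entH_comp_injective (fun ω => (A b n ω, Q b n ω, F ω))
        (f := fun p => (res (fun i => k ≤ (i : ℕ) + 1) p.2.2, (p.2.1, p.1),
          res (fun i => (i : ℕ) + 1 < k) p.2.2)) (by
        rintro ⟨u, t, w⟩ ⟨u', t', w'⟩ h
        simp only [Prod.mk.injEq, funext_iff, res, Subtype.forall] at h
        have : w = w' := by
          funext i
          by_cases hi : (i : ℕ) + 1 < k
          · exact h.2.2 i hi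
          · exact h.1 i (by omega)
        simp only [Prod.mk.injEq]
        exact ⟨h.2.1.2, h.2.1.1, this⟩)
    have hj2 : entH μ (fun ω => ((Q b n ω, A b n ω), V ω)) =
        entH μ (fun ω => (A b n ω, Q b n ω, V ω)) :=
      entH_comp_injective (fun ω => (A b n ω, Q b n ω, V ω))
        (f := fun p => ((p.2.1, p.1), p.2.2)) (by
        rintro ⟨u, t, w⟩ ⟨u', t', w'⟩ h
        simp only [Prod.mk.injEq] at h ⊢
        tauto)
    have hd := hdet b hMb n
    change entH μ (fun ω => ((Q a n ω, A a n ω), V ω)) =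
      entH μ (fun ω => ((Q b n ω, A b n ω), V ω)) at hp1
    change entH μ (fun ω => (X ω, (Q a n ω, A a n ω), V ω)) =
      entH μ (fun ω => (X ω, (Q b n ω, A b n ω), V ω)) at hp2
    change condH μ (A b n) (fun ω => (Q b n ω, F ω)) = 0 at hd
    change _ ≤ condH μ (A b n) (fun ω => (Q b n ω, V ω)) at hcq
    change _ ≤ condH μ X (fun ω => ((Q a n ω, A a n ω), V ω)) at hdp
    rw [condMI_eq_condH_sub]
    refine hcq.trans (le_trans ?_ (sub_le_sub_left hdp _))
    unfold condH at hd ⊢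
    linarith
  have hsum : condH μ R (fun ω => (q ω, V ω)) ≤
      N * condMI μ X (fun ω => ((fun n => Q a n ω), (fun n => A a n ω))) V := by
    refine (condH_pi_le_sum (hqm.prodMk hVm) (A b) (hAm b)).trans ?_
    refine (Finset.sum_le_sum fun n _ => hsingle n).trans ?_
    simp
  -- reliability
  have hrb := (condH_le_condH_comp (μ := μ) (hWm b) (hqm.prodMk (hRm.prodMk hVm))
    (fun p => (p.1, p.2.1, (fun i => p.2.2 ⟨i.1, by omega⟩ :
      {i : Fin K // (i : ℕ) < M} → S)))).trans (hrel b hMb)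
  have hj1 : entH μ (fun ω => ((q ω, R ω), V' ω)) =
      entH μ (fun ω => (W b ω, q ω, R ω, V ω)) := by
    symm
    refine entH_comp_injective (fun ω => ((q ω, R ω), V' ω))
      (f := fun p : ((Fin N → T) × (Fin N → U)) × ({i : Fin K // (i : ℕ) < k} → S) =>
        (p.2 ⟨b, by omega⟩, p.1.1, p.1.2,
        (fun i => p.2 ⟨i.1, by omega⟩ : {i : Fin K // (i : ℕ) + 1 < k} → S))) ?_
    rintro ⟨⟨t, u⟩, w⟩ ⟨⟨t', u'⟩, w'⟩ h
    simp only [Prod.mk.injEq, funext_iff (α := {i : Fin K // (i : ℕ) + 1 < k}),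
      Subtype.forall] at h
    simp only [Prod.mk.injEq]
    refine ⟨⟨h.2.1, h.2.2.1⟩, ?_⟩
    funext ⟨i, hi⟩
    by_cases hi' : (i : ℕ) + 1 < k
    · exact h.2.2.2 i hi'
    · have : i = b := Fin.ext (by omega)
      subst this
      exact h.1
  have hj2 : entH μ (fun ω => (R ω, q ω, V ω)) = entH μ (fun ω => (q ω, R ω, V ω)) :=
    entH_comp_injective (fun ω => (q ω, R ω, V ω)) (f := fun p => (p.2.1, p.1, p.2.2)) (by
      rintro ⟨u, t, w⟩ ⟨u', t', w'⟩ h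
      simp only [Prod.mk.injEq] at h ⊢
      tauto)
  have hj3 : entH μ (fun ω => (X' ω, (q ω, R ω), V' ω)) = entH μ (fun ω => (R ω, q ω, F ω)) :=
    entH_comp_injective (fun ω => (R ω, q ω, F ω))
      (f := fun p => (res (fun i => k ≤ (i : ℕ)) p.2.2, (p.2.1, p.1),
        res (fun i => (i : ℕ) < k) p.2.2)) (by
      rintro ⟨u, t, w⟩ ⟨u', t', w'⟩ h
      simp only [Prod.mk.injEq, funext_iff (α := {i : Fin K // _}), res, Subtype.forall] at h
      have : w = w' := by
        funext i
        by_cases hi : (i : ℕ) < k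
        · exact h.2.2 i hi
        · exact h.1 i (by omega)
      simp only [Prod.mk.injEq]
      exact ⟨h.2.1.2, h.2.1.1, this⟩)
  have hmono := entH_le_entH_pair (μ := μ) hRm (hqm.prodMk hFm)
  have hmain : condMI μ X' (fun ω => (q ω, R ω)) V' + (ℓ - ε) ≤
      condH μ R (fun ω => (q ω, V ω)) := by
    rw [condMI_eq_condH_sub]
    unfold condH at hrb ⊢
    linarith
  have hN0 : (0 : ℝ) < N := by exact_mod_cast (by omega : 0 < N)
  have hle := hmain.trans hsum
  rw [ge_iff_le, one_div_mul_eq_div, ← add_div, div_le_iff₀' hN0]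
  exact hle
end

section
/- Converse bound (Theorem 1, converse direction, finite-error form): Under the scheme hypotheses (independence, answer determinism, privacy, ε-reliability), the download cost satisfies D ≥ ℓ · Σ_{i=0}^{K−M−1} (1/N)^i − (K − M + 1) · ε. In particular, for a perfectly reliable scheme (ε = 0), D/ℓ ≥ 1 + 1/N + ⋯ + 1/N^{K−M−1}. -/
open MeasureTheory

namespace EntropyAux
open ProbabilityTheory

variable {Ω : Type*} [MeasurableSpace Ω] {μ : Measure Ω}

section Law
variable {S : Type*} [Fintype S] [MeasurableSpace S] [MeasurableSingletonClass S]

theorem sum_real_fiber [IsFiniteMeasure μ] {T : Type*} [DecidableEq T]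
    {X : Ω → S} (hX : Measurable X) (f : S → T) (t : T) :
    ∑ s with f s = t, μ.real (X ⁻¹' {s}) = μ.real ((f ∘ X) ⁻¹' {t}) := by
  rw [sum_measureReal_preimage_singleton _ fun s _ => hX (measurableSet_singleton s)]
  congr 1
  ext ω
  simp

theorem entH_comp [IsFiniteMeasure μ] {T : Type*} [Fintype T]
    {X : Ω → S} (hX : Measurable X) (f : S → T) :
    entH μ (f ∘ X) =
      ∑ s, -(μ.real (X ⁻¹' {s}) * Real.log (μ.real ((f ∘ X) ⁻¹' {f s}))) := by
  classical
  rw [← Finset.sum_fiberwise Finset.univ f]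
  refine Finset.sum_congr rfl fun t _ => ?_
  change Real.negMulLog (μ.real ((f ∘ X) ⁻¹' {t})) = _
  rw [Real.negMulLog, neg_mul, ← sum_real_fiber hX f t, Finset.sum_mul,
    ← Finset.sum_neg_distrib]
  refine Finset.sum_congr rfl fun s hs => ?_
  rw [(Finset.mem_filter.1 hs).2, sum_real_fiber hX f t]

theorem entH_comp_le [IsFiniteMeasure μ] {T : Type*} [Fintype T]
    {X : Ω → S} (hX : Measurable X) (f : S → T) : entH μ (f ∘ X) ≤ entH μ X := by
  rw [entH_comp hX f]
  refine Finset.sum_le_sum fun s _ => ?_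
  change _ ≤ Real.negMulLog (μ.real (X ⁻¹' {s}))
  rw [Real.negMulLog, neg_mul, neg_le_neg_iff]
  rcases (measureReal_nonneg (μ := μ) (s := X ⁻¹' {s})).eq_or_lt with h | h
  · simp [← h]
  · have hle : μ.real (X ⁻¹' {s}) ≤ μ.real ((f ∘ X) ⁻¹' {f s}) := measureReal_mono <| by
      rintro ω rfl
      rfl
    gcongr

theorem entH_le_of_eq_comp [IsFiniteMeasure μ] {T : Type*} [Fintype T]
    {X : Ω → S} {Y : Ω → T} (hX : Measurable X) (f : S → T) (h : ∀ ω, Y ω = f (X ω)) :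
    entH μ Y ≤ entH μ X := by
  obtain rfl : Y = f ∘ X := funext h
  exact entH_comp_le hX f

theorem entH_comp_congr [IsFiniteMeasure μ] {T : Type*} [Fintype T] {X Y : Ω → S}
    (hX : Measurable X) (hY : Measurable Y) (h : ∀ s, μ (X ⁻¹' {s}) = μ (Y ⁻¹' {s}))
    (f : S → T) : entH μ (f ∘ X) = entH μ (f ∘ Y) := by
  classical
  refine Finset.sum_congr rfl fun t _ => ?_
  change Real.negMulLog (μ.real _) = Real.negMulLog (μ.real _)
  rw [← sum_real_fiber hX, ← sum_real_fiber hY]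
  simp only [measureReal_def, h]

theorem sum_real_preimage_singleton [IsProbabilityMeasure μ] {X : Ω → S} (hX : Measurable X) :
    ∑ s, μ.real (X ⁻¹' {s}) = 1 := by
  rw [sum_measureReal_preimage_singleton _ fun s _ => hX (measurableSet_singleton s)]
  simp

end Law

section Pair
variable {S T U : Type*} [Fintype S] [Fintype T] [Fintype U]
  [MeasurableSpace S] [MeasurableSpace T] [MeasurableSpace U]
  [MeasurableSingletonClass S] [MeasurableSingletonClass T] [MeasurableSingletonClass U]

theorem entH_prod_of_indepFun [IsProbabilityMeasure μ] {X : Ω → S} {Y : Ω → T}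
    (hX : Measurable X) (hY : Measurable Y) (h : IndepFun X Y μ) :
    entH μ (fun ω => (X ω, Y ω)) = entH μ X + entH μ Y := by
  have key : ∀ x y, μ.real ((fun ω => (X ω, Y ω)) ⁻¹' {(x, y)}) =
      μ.real (X ⁻¹' {x}) * μ.real (Y ⁻¹' {y}) := fun x y => by
    have := h.measure_inter_preimage_eq_mul {x} {y} (measurableSet_singleton x)
      (measurableSet_singleton y)
    rw [measureReal_def, measureReal_def, measureReal_def, ← ENNReal.toReal_mul, ← this]
    congr 2
    ext ω
    simp
  change ∑ p : S × T, Real.negMulLog (μ.real _) =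
    ∑ x, Real.negMulLog (μ.real _) + ∑ y, Real.negMulLog (μ.real _)
  rw [Fintype.sum_prod_type]
  simp_rw [key, Real.negMulLog_mul, Finset.sum_add_distrib, ← Finset.sum_mul, ← Finset.mul_sum,
    ← Finset.sum_mul, sum_real_preimage_singleton hX, sum_real_preimage_singleton hY, one_mul]

theorem sum_real_prod_left [IsFiniteMeasure μ] {X : Ω → S} {Z : Ω → U}
    (hX : Measurable X) (hZ : Measurable Z) (z : U) :
    ∑ x, μ.real ((fun ω => (X ω, Z ω)) ⁻¹' {(x, z)}) = μ.real (Z ⁻¹' {z}) := by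
  classical
  have h := sum_real_fiber (μ := μ) (hX.prodMk hZ) Prod.snd z
  rw [Finset.sum_filter, Fintype.sum_prod_type] at h
  simpa [Function.comp_def] using h

theorem entH_prod_prod_add_le [IsProbabilityMeasure μ] {X : Ω → S} {Y : Ω → T} {Z : Ω → U}
    (hX : Measurable X) (hY : Measurable Y) (hZ : Measurable Z) :
    entH μ (fun ω => (X ω, Y ω, Z ω)) + entH μ Z ≤
      entH μ (fun ω => (X ω, Z ω)) + entH μ (fun ω => (Y ω, Z ω)) := by
  have hV : Measurable fun ω => (X ω, Y ω, Z ω) := by fun_prop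
  have h0 := entH_comp (μ := μ) hV id
  have h1 := entH_comp (μ := μ) hV fun v => v.2.2
  have h2 := entH_comp (μ := μ) hV fun v => (v.1, v.2.2)
  have h3 := entH_comp (μ := μ) hV fun v => v.2
  simp only [Function.comp_def, id] at h0 h1 h2 h3
  rw [h0, h1, h2, h3, ← Finset.sum_add_distrib, ← Finset.sum_add_distrib, ← sub_nonneg,
    ← Finset.sum_sub_distrib]
  set p : S × T × U → ℝ := fun v => μ.real ((fun ω => (X ω, Y ω, Z ω)) ⁻¹' {v})
  set a : S × U → ℝ := fun v => μ.real ((fun ω => (X ω, Z ω)) ⁻¹' {v})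
  set b : T × U → ℝ := fun v => μ.real ((fun ω => (Y ω, Z ω)) ⁻¹' {v})
  set c : U → ℝ := fun v => μ.real (Z ⁻¹' {v})
  have hsum : ∑ v : S × T × U, (p v - a (v.1, v.2.2) * b v.2 / c v.2.2) = 0 := by
    rw [Finset.sum_sub_distrib, sum_real_preimage_singleton hV, Fintype.sum_prod_type_right,
      Fintype.sum_prod_type_right]
    simp_rw [← Finset.sum_div, ← Finset.sum_mul, ← Finset.mul_sum]
    simp only [a, b, c, sum_real_prod_left hX hZ, sum_real_prod_left hY hZ, mul_self_div_self,
      sum_real_preimage_singleton hZ, sub_self]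
  rw [← hsum]
  refine Finset.sum_le_sum fun v _ => ?_
  change _ ≤ -(p v * Real.log (a (v.1, v.2.2))) + -(p v * Real.log (b v.2)) -
    (-(p v * Real.log (p v)) + -(p v * Real.log (c v.2.2)))
  rcases (measureReal_nonneg : 0 ≤ p v).eq_or_lt with h | h
  · have : 0 ≤ a (v.1, v.2.2) * b v.2 / c v.2.2 :=
      div_nonneg (mul_nonneg measureReal_nonneg measureReal_nonneg) measureReal_nonneg
    change 0 = p v at h
    rw [← h]
    linarith
  · change 0 < p v at h
    have ha : 0 < a (v.1, v.2.2) := h.trans_le <| measureReal_mono <| by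
      rintro ω rfl
      rfl
    have hb : 0 < b v.2 := h.trans_le <| measureReal_mono <| by
      rintro ω rfl
      rfl
    have hc : 0 < c v.2.2 := h.trans_le <| measureReal_mono <| by
      rintro ω rfl
      rfl
    have hlog := Real.log_le_sub_one_of_pos (x := a (v.1, v.2.2) * b v.2 / (p v * c v.2.2))
      (by positivity)
    rw [Real.log_div (by positivity) (by positivity), Real.log_mul ha.ne' hb.ne',
      Real.log_mul h.ne' hc.ne'] at hlog
    have hmul := mul_le_mul_of_nonneg_left hlog h.le
    have hx : p v * (a (v.1, v.2.2) * b v.2 / (p v * c v.2.2) - 1) =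
        a (v.1, v.2.2) * b v.2 / c v.2.2 - p v := by
      field_simp
    rw [hx] at hmul
    linarith

theorem entH_submodular [IsProbabilityMeasure μ] {I J : Type*} [Fintype I] [Fintype J]
    {X : Ω → S} {Y : Ω → T} {Z : Ω → I} {V : Ω → J} (hX : Measurable X) (hY : Measurable Y)
    (f : S → I) (g : T → I) (j : S → T → J) (hf : ∀ ω, Z ω = f (X ω)) (hg : ∀ ω, Z ω = g (Y ω))
    (hj : ∀ ω, V ω = j (X ω) (Y ω)) :
    entH μ V + entH μ Z ≤ entH μ X + entH μ Y := by
  let _ : MeasurableSpace I := ⊤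
  have hZ : Measurable Z := by
    rw [show Z = f ∘ X from funext hf]
    exact (measurable_of_countable f).comp hX
  have h := entH_prod_prod_add_le (μ := μ) hX hY hZ
  have h1 : entH μ V ≤ entH μ fun ω => (X ω, Y ω, Z ω) :=
    entH_le_of_eq_comp (by fun_prop) (fun v => j v.1 v.2.1) hj
  have h2 : entH μ (fun ω => (X ω, Z ω)) ≤ entH μ X :=
    entH_le_of_eq_comp hX (fun x => (x, f x)) fun ω => by rw [hf]
  have h3 : entH μ (fun ω => (Y ω, Z ω)) ≤ entH μ Y :=
    entH_le_of_eq_comp hY (fun y => (y, g y)) fun ω => by rw [hg]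
  linarith

theorem condH_nonneg [IsFiniteMeasure μ] {X : Ω → S} {Y : Ω → T}
    (hX : Measurable X) (hY : Measurable Y) : 0 ≤ condH μ X Y :=
  sub_nonneg.2 <| entH_le_of_eq_comp (hX.prodMk hY) Prod.snd fun _ => rfl

theorem condH_le_entH [IsProbabilityMeasure μ] {X : Ω → S} {Y : Ω → T}
    (hX : Measurable X) (hY : Measurable Y) : condH μ X Y ≤ entH μ X := by
  have h := entH_submodular (μ := μ) (Z := fun _ => ()) (V := fun ω => (X ω, Y ω)) hX hY
    (fun _ => ()) (fun _ => ()) Prod.mk (fun _ => rfl) (fun _ => rfl) fun _ => rfl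
  have h0 : 0 ≤ entH μ fun _ : Ω => () := by simp [entH]
  rw [condH]
  linarith

/-- Conditioning on more information decreases conditional entropy. -/
theorem condH_anti [IsProbabilityMeasure μ] {X : Ω → S} {Y : Ω → T} {Z : Ω → U}
    (hX : Measurable X) (hY : Measurable Y) (hZ : Measurable Z) (f : T → U)
    (h : ∀ ω, Z ω = f (Y ω)) : condH μ X Y ≤ condH μ X Z := by
  have := entH_submodular (μ := μ) (Z := Z) (V := fun ω => (X ω, Y ω)) (hX.prodMk hZ) hY
    Prod.snd f (fun p y => (p.1, y)) (fun _ => rfl) h fun _ => rfl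
  rw [condH, condH]
  linarith

theorem condH_mono [IsFiniteMeasure μ] {J : Type*} [Fintype J] {X : Ω → S} {Y : Ω → J}
    {Z : Ω → U} (hX : Measurable X) (hZ : Measurable Z) (f : S → J)
    (h : ∀ ω, Y ω = f (X ω)) : condH μ Y Z ≤ condH μ X Z := by
  rw [condH, condH]
  gcongr
  exact entH_le_of_eq_comp (hX.prodMk hZ) (fun p => (f p.1, p.2)) fun ω => by rw [h]

theorem condH_pi_le_sum [IsProbabilityMeasure μ] {Z : Ω → U} (hZ : Measurable Z) :
    ∀ {N : ℕ} {X : Fin N → Ω → S} (_ : ∀ n, Measurable (X n)),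
      condH μ (fun ω n => X n ω) Z ≤ ∑ n, condH μ (X n) Z
  | 0, X, _ => by
    have := entH_le_of_eq_comp (μ := μ) (Y := fun ω => ((fun n => X n ω : Fin 0 → S), Z ω)) hZ
      (fun z => (Fin.elim0, z)) fun ω => by simp [Subsingleton.elim _ (Fin.elim0 : Fin 0 → S)]
    simpa [condH] using this
  | N + 1, X, hX => by
    have ih := condH_pi_le_sum hZ (X := fun n => X n.succ) fun n => hX n.succ
    have ht : Measurable fun ω (n : Fin N) => X n.succ ω := measurable_pi_iff.2 fun n => hX _
    have h := entH_submodular (μ := μ) (Z := Z) (V := fun ω => ((fun n => X n ω), Z ω))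
      ((hX 0).prodMk hZ) (ht.prodMk hZ) Prod.snd Prod.snd
      (fun p q => (Fin.cons p.1 q.1, p.2)) (fun _ => rfl) (fun _ => rfl) fun ω => by
        refine Prod.ext (funext fun n => ?_) rfl
        cases n using Fin.cases <;> rfl
    rw [Fin.sum_univ_succ]
    rw [condH] at ih ⊢
    rw [condH]
    linarith

theorem indepFun_of_singleton [IsFiniteMeasure μ] {X : Ω → S} {Y : Ω → T}
    (hX : Measurable X) (hY : Measurable Y)
    (h : ∀ x y, μ {ω | X ω = x ∧ Y ω = y} = μ {ω | X ω = x} * μ {ω | Y ω = y}) :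
    IndepFun X Y μ := by
  rw [indepFun_iff_map_prod_eq_prod_map_map hX.aemeasurable hY.aemeasurable]
  refine Measure.ext_of_singleton fun ⟨x, y⟩ => ?_
  rw [← Set.singleton_prod_singleton, Measure.prod_prod,
    Measure.map_apply hX (measurableSet_singleton x),
    Measure.map_apply hY (measurableSet_singleton y), Set.singleton_prod_singleton,
    Measure.map_apply (hX.prodMk hY) (measurableSet_singleton _)]
  refine Eq.trans (congrArg μ ?_) (h x y)
  ext ω
  simp

theorem iIndepFun_of_singleton [IsProbabilityMeasure μ] {ι : Type*} [Fintype ι]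
    {X : ι → Ω → S} (hX : ∀ i, Measurable (X i))
    (h : ∀ x : ι → S, μ {ω | ∀ i, X i ω = x i} = ∏ i, μ {ω | X i ω = x i}) :
    iIndepFun X μ := by
  rw [iIndepFun_iff_map_fun_eq_pi_map fun i => (hX i).aemeasurable]
  have := fun i => Measure.isProbabilityMeasure_map (μ := μ) (hX i).aemeasurable
  refine Measure.ext_of_singleton fun x => ?_
  rw [Measure.pi_singleton,
    Measure.map_apply (measurable_pi_iff.2 hX) (measurableSet_singleton x)]
  refine (congrArg μ ?_).trans <| (h x).trans <| Finset.prod_congr rfl fun i _ =>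
    (Measure.map_apply (hX i) (measurableSet_singleton (x i))).symm
  ext ω
  simp [funext_iff]

/-- If `X` is determined by a function of `Y` together with `W`, and `Y` is independent of `W`,
then the remaining information in `Y` does not reduce the uncertainty of `X`, even given partial
knowledge of `W`. -/
theorem condH_le_of_indepFun [IsProbabilityMeasure μ] {I J : Type*} [Fintype I] [Fintype J]
    [MeasurableSpace I] [MeasurableSpace J]
    [MeasurableSingletonClass I] [MeasurableSingletonClass J] {X : Ω → S} {Y : Ω → T} {W : Ω → U}
    (hX : Measurable X) (hY : Measurable Y) (hW : Measurable W) (h : IndepFun Y W μ)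
    (f : T → I) (g : U → J) (h0 : condH μ X (fun ω => (f (Y ω), W ω)) = 0) :
    condH μ X (fun ω => (f (Y ω), g (W ω))) ≤ condH μ X (fun ω => (Y ω, g (W ω))) := by
  have hf := measurable_of_countable f
  have hg := measurable_of_countable g
  have hsub := entH_submodular (μ := μ) (X := fun ω => (X ω, Y ω, g (W ω)))
    (Y := fun ω => (X ω, f (Y ω), W ω)) (Z := fun ω => (X ω, f (Y ω), g (W ω)))
    (V := fun ω => (X ω, Y ω, W ω)) (by fun_prop) (by fun_prop) (fun p => (p.1, f p.2.1, p.2.2))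
    (fun p => (p.1, p.2.1, g p.2.2)) (fun p q => (p.1, p.2.1, q.2.2))
    (fun _ => rfl) (fun _ => rfl) fun _ => rfl
  have hmono := entH_le_of_eq_comp (μ := μ) (X := fun ω => (X ω, Y ω, W ω))
    (Y := fun ω => (Y ω, W ω)) (by fun_prop) Prod.snd fun _ => rfl
  rw [entH_prod_of_indepFun hY hW h] at hmono
  have h1 := entH_prod_of_indepFun (hf.comp hY) hW (h.comp hf measurable_id)
  have h2 := entH_prod_of_indepFun (hf.comp hY) (hg.comp hW) (h.comp hf hg)
  have h3 := entH_prod_of_indepFun hY (hg.comp hW) (h.comp measurable_id hg)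
  simp only [condH, Function.comp_apply] at *
  linarith

/-- If `W` can be recovered from `(Q, A, V)` up to `ε` and is independent of `V`, then it
contributes its entropy to the uncertainty of `A`. -/
theorem entH_sub_add_condH_le [IsProbabilityMeasure μ] {R : Type*} [Fintype R]
    [MeasurableSpace R] [MeasurableSingletonClass R]
    {W : Ω → S} {Q : Ω → T} {A : Ω → U} {V : Ω → R}
    (hW : Measurable W) (hQ : Measurable Q) (hA : Measurable A) (hV : Measurable V)
    (hVW : IndepFun V W μ) (hQVW : IndepFun Q (fun ω => (V ω, W ω)) μ) {ε : ℝ}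
    (hε : condH μ W (fun ω => (Q ω, A ω, V ω)) ≤ ε) :
    entH μ W - ε + condH μ A (fun ω => (Q ω, V ω, W ω)) ≤ condH μ A (fun ω => (Q ω, V ω)) := by
  have h1 := entH_prod_of_indepFun hV hW hVW
  have h2 := entH_prod_of_indepFun hQ (hV.prodMk hW) hQVW
  have h3 := entH_prod_of_indepFun hQ hV (hQVW.comp measurable_id measurable_fst)
  have h4 := entH_le_of_eq_comp (μ := μ) (X := fun ω => (W ω, Q ω, A ω, V ω))
    (Y := fun ω => (A ω, Q ω, V ω, W ω)) (by fun_prop)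
    (fun p => (p.2.2.1, p.2.1, p.2.2.2, p.1)) fun _ => rfl
  have h5 := entH_le_of_eq_comp (μ := μ) (X := fun ω => (A ω, Q ω, V ω))
    (Y := fun ω => (Q ω, A ω, V ω)) (by fun_prop) (fun p => (p.2.1, p.1, p.2.2)) fun _ => rfl
  simp only [condH] at *
  linarith

theorem condH_comp_congr [IsFiniteMeasure μ] {I J : Type*} [Fintype I] [Fintype J]
    {X Y : Ω → S} (hX : Measurable X) (hY : Measurable Y)
    (h : ∀ s, μ (X ⁻¹' {s}) = μ (Y ⁻¹' {s})) (f : S → I) (g : S → J) :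
    condH μ (f ∘ X) (g ∘ X) = condH μ (f ∘ Y) (g ∘ Y) :=
  congrArg₂ (· - ·) (entH_comp_congr hX hY h fun s => (f s, g s)) (entH_comp_congr hX hY h g)

end Pair

section Scheme

/-- The messages with index smaller than `m`. -/
def messagesBelow {S : Type*} {K : ℕ} (W : Fin K → Ω → S) (m : ℕ) (ω : Ω) :
    {i : Fin K // (i : ℕ) < m} → S :=
  fun i => W i.1 ω

theorem measurable_messagesBelow {S : Type*} [MeasurableSpace S] {K : ℕ} {W : Fin K → Ω → S}
    (hW : ∀ i, Measurable (W i)) (m : ℕ) : Measurable (messagesBelow W m) :=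
  measurable_pi_iff.2 fun i => hW i.1

theorem indepFun_messagesBelow {S : Type*} [MeasurableSpace S] {K : ℕ} {W : Fin K → Ω → S}
    (hW : ∀ i, Measurable (W i)) (h : iIndepFun W μ) (k : Fin K) :
    IndepFun (messagesBelow W k) (W k) μ := by
  have hd : Disjoint (Finset.univ.filter fun i : Fin K => (i : ℕ) < k) {k} := by simp
  let f (v : {i // i ∈ Finset.univ.filter fun i : Fin K => (i : ℕ) < k} → S)
    (i : {i : Fin K // (i : ℕ) < k}) : S := v ⟨i.1, by simpa using i.2⟩
  let g (v : {i // i ∈ ({k} : Finset (Fin K))} → S) : S := v ⟨k, by simp⟩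
  have hf : Measurable f := by fun_prop
  have hg : Measurable g := by fun_prop
  exact (h.indepFun_finset _ _ hd hW).comp hf hg

variable {S T U : Type*} [Fintype S] [Fintype T] [Fintype U]
  [MeasurableSpace S] [MeasurableSpace T] [MeasurableSpace U]
  [MeasurableSingletonClass S] [MeasurableSingletonClass T] [MeasurableSingletonClass U]

variable {N K M : ℕ} {W : Fin K → Ω → S} {Q : Fin K → Fin N → Ω → T} {A : Fin K → Fin N → Ω → U}
  {ℓ ε : ℝ}

/-- The uncertainty of all answers when message `k` is desired, given all queries and the
messages with index smaller than `m`. -/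
noncomputable def answersH (μ : Measure Ω) (W : Fin K → Ω → S) (Q : Fin K → Fin N → Ω → T)
    (A : Fin K → Fin N → Ω → U) (k : Fin K) (m : ℕ) : ℝ :=
  condH μ (fun ω n => A k n ω) (fun ω => ((fun n => Q k n ω), messagesBelow W m ω))

theorem answersH_nonneg (h : SchemeHyps N K M μ W Q A ℓ ε) (k : Fin K) (m : ℕ) :
    0 ≤ answersH μ W Q A k m := by
  obtain ⟨_, hW, hQ, hA, -⟩ := h
  have hV := measurable_messagesBelow hW m
  exact condH_nonneg (by fun_prop) (by fun_prop)

theorem answersH_le_sum (h : SchemeHyps N K M μ W Q A ℓ ε) (k : Fin K) (m : ℕ) :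
    answersH μ W Q A k m ≤
      ∑ n, condH μ (A k n) (fun ω => ((fun n => Q k n ω), messagesBelow W m ω)) := by
  obtain ⟨_, hW, hQ, hA, -⟩ := h
  have hV := measurable_messagesBelow hW m
  exact condH_pi_le_sum (by fun_prop) (hA k)

theorem indepFun_queries_messages (h : SchemeHyps N K M μ W Q A ℓ ε) {k : Fin K}
    (hk : M ≤ (k : ℕ)) : IndepFun (fun ω n => Q k n ω) (fun ω i => W i ω) μ := by
  obtain ⟨_, hW, hQ, -, -, -, hQW, -⟩ := h
  refine indepFun_of_singleton (by fun_prop) (by fun_prop) fun q w => ?_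
  simpa only [funext_iff] using hQW k hk q w

theorem answersH_succ_le (h : SchemeHyps N K M μ W Q A ℓ ε) {k : Fin K} (hk : M ≤ (k : ℕ)) :
    ℓ - ε + answersH μ W Q A k (k + 1) ≤ answersH μ W Q A k k := by
  have hQW := indepFun_queries_messages h hk
  obtain ⟨_, hW, hQ, hA, hℓ, hWW, -, -, -, hrel⟩ := h
  have hV := measurable_messagesBelow hW
  have hQ' : Measurable fun ω n => Q k n ω := by fun_prop
  have hA' : Measurable fun ω n => A k n ω := by fun_prop
  have hQVW : IndepFun (fun ω n => Q k n ω) (fun ω => (messagesBelow W k ω, W k ω)) μ := by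
    let f (w : Fin K → S) : ({i : Fin K // (i : ℕ) < k} → S) × S := (fun i => w i.1, w k)
    have hf : Measurable f := by fun_prop
    exact hQW.comp measurable_id hf
  have hrel' : condH μ (W k)
      (fun ω => ((fun n => Q k n ω), (fun n => A k n ω), messagesBelow W k ω)) ≤ ε :=
    (condH_anti (Z := fun ω => ((fun n => Q k n ω), (fun n => A k n ω), messagesBelow W M ω))
      (hW k) (hQ'.prodMk (hA'.prodMk (hV k))) (hQ'.prodMk (hA'.prodMk (hV M)))
      (fun p => (p.1, p.2.1, fun i => p.2.2 ⟨i.1, i.2.trans_le hk⟩)) fun _ => rfl).trans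
      (hrel k hk)
  have hstep := entH_sub_add_condH_le (hW k) hQ' hA' (hV k)
    (indepFun_messagesBelow hW (iIndepFun_of_singleton hW hWW) k) hQVW hrel'
  rw [hℓ] at hstep
  refine le_trans (add_le_add_right ?_ _) hstep
  exact condH_anti hA' (hQ'.prodMk (hV (k + 1))) (hQ'.prodMk ((hV k).prodMk (hW k)))
    (fun p => (p.1, (fun i => p.2 ⟨i.1, i.2.trans k.1.lt_succ_self⟩), p.2 ⟨k, k.1.lt_succ_self⟩))
    fun _ => rfl

theorem answersH_le_mul (h : SchemeHyps N K M μ W Q A ℓ ε) {k k' : Fin K}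
    (hk : M ≤ (k : ℕ)) (hk' : M ≤ (k' : ℕ)) (m : ℕ) :
    answersH μ W Q A k' m ≤ N * answersH μ W Q A k m := by
  have hQW := indepFun_queries_messages h hk
  refine (answersH_le_sum h k' m).trans ?_
  obtain ⟨_, hW, hQ, hA, -, -, -, hdet, hpriv, -⟩ := h
  have hV := measurable_messagesBelow hW m
  refine (Finset.sum_le_card_nsmul Finset.univ _ (answersH μ W Q A k m) fun n _ => ?_).trans_eq
    (by simp)
  calc condH μ (A k' n) (fun ω => ((fun n => Q k' n ω), messagesBelow W m ω))
      ≤ condH μ (A k' n) (fun ω => (Q k' n ω, messagesBelow W m ω)) :=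
        condH_anti (hA k' n) (by fun_prop) (by fun_prop) (fun p => (p.1 n, p.2)) fun _ => rfl
    _ = condH μ (A k n) (fun ω => (Q k n ω, messagesBelow W m ω)) :=
        condH_comp_congr (X := fun ω => (Q k' n ω, A k' n ω, fun i => W i ω))
          (Y := fun ω => (Q k n ω, A k n ω, fun i => W i ω)) (by fun_prop) (by fun_prop)
          (fun s => by
            simpa [Set.preimage, Prod.ext_iff, funext_iff] using
              hpriv n k' k hk' hk s.1 s.2.1 s.2.2)
          (fun s => s.2.1) fun s => (s.1, fun i : {i : Fin K // (i : ℕ) < m} => s.2.2 i.1)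
    _ ≤ condH μ (A k n) (fun ω => ((fun n => Q k n ω), messagesBelow W m ω)) :=
        condH_le_of_indepFun (hA k n) (by fun_prop) (by fun_prop) hQW (fun q => q n)
          (fun w (i : {i : Fin K // (i : ℕ) < m}) => w i.1) (hdet k hk n)
    _ ≤ answersH μ W Q A k m :=
        condH_mono (by fun_prop) (by fun_prop) (fun a => a n) fun _ => rfl

theorem mul_geom_sum_le_answersH (hN : 0 < N) (h : SchemeHyps N K M μ W Q A ℓ ε) (j : ℕ) :
    ∀ k : Fin K, M ≤ (k : ℕ) → (k : ℕ) + j = K →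
      (ℓ - ε) * ∑ i ∈ Finset.range j, (1 / (N : ℝ)) ^ i ≤ answersH μ W Q A k k := by
  induction j with
  | zero => exact fun k _ hj => absurd hj k.2.ne
  | succ j ih =>
    intro k hk hj
    refine le_trans ?_ (answersH_succ_le h hk)
    rw [geom_sum_succ, mul_add, mul_one, add_comm]
    gcongr
    rcases j.eq_zero_or_pos with rfl | hj0
    · simpa using answersH_nonneg h k _
    · have hk1 : (k : ℕ) + 1 < K := by omega
      have h1 := ih ⟨k + 1, hk1⟩ (by simp; omega) (by simp; omega)
      have h2 := answersH_le_mul h hk (k' := ⟨k + 1, hk1⟩) (by simp; omega) (k + 1)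
      have hN' : (0 : ℝ) < N := by exact_mod_cast hN
      rw [mul_left_comm, one_div_mul_eq_div, div_le_iff₀' hN']
      simpa using h1.trans h2

end Scheme

end EntropyAux

/-- **Converse bound (Theorem 1, converse direction, finite-error form).** Under the scheme
hypotheses (independence, answer determinism, privacy, ε-reliability), the download cost
`D = ∑ₙ H(Aₙ^[M+1])` satisfies `D ≥ ℓ·∑_{i=0}^{K−M−1} (1/N)^i − (K − M + 1)·ε`; in particular,
for a perfectly reliable scheme (`ε = 0`), `D/ℓ ≥ 1 + 1/N + ⋯ + 1/N^{K−M−1}`.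
(Messages are 0-indexed: `W i` for `i : Fin K` is the paper's `W_{i+1}`, and the paper's
desired index `M+1` is `⟨M, _⟩ : Fin K`.) -/
theorem converse_bound_finite_error
    (N K M : ℕ) (hN : 2 ≤ N) (hK : 2 ≤ K) (hMK : M < K)
    {Ω : Type*} [MeasurableSpace Ω] (μ : Measure Ω)
    {S T U : Type*} [Fintype S] [Fintype T] [Fintype U]
    [MeasurableSpace S] [MeasurableSpace T] [MeasurableSpace U]
    [MeasurableSingletonClass S] [MeasurableSingletonClass T] [MeasurableSingletonClass U]
    (W : Fin K → Ω → S) (Q : Fin K → Fin N → Ω → T) (A : Fin K → Fin N → Ω → U)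
    (ℓ ε : ℝ) (hℓ : 0 < ℓ) (hε : 0 ≤ ε)
    (hScheme : SchemeHyps N K M μ W Q A ℓ ε) :
    (∑ n : Fin N, entH μ (A ⟨M, hMK⟩ n)) ≥
        ℓ * (∑ i ∈ Finset.range (K - M), (1 / (N : ℝ)) ^ i) - ((K : ℝ) - (M : ℝ) + 1) * ε ∧
    (ε = 0 →
      (∑ n : Fin N, entH μ (A ⟨M, hMK⟩ n)) / ℓ ≥
        ∑ i ∈ Finset.range (K - M), (1 / (N : ℝ)) ^ i) := by
  have hmain : (ℓ - ε) * ∑ i ∈ Finset.range (K - M), (1 / (N : ℝ)) ^ i ≤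
      ∑ n, entH μ (A ⟨M, hMK⟩ n) := by
    refine (EntropyAux.mul_geom_sum_le_answersH (by omega) hScheme _ ⟨M, hMK⟩ le_rfl
      (Nat.add_sub_of_le hMK.le)).trans ((EntropyAux.answersH_le_sum hScheme _ _).trans ?_)
    obtain ⟨_, hW, hQ, hA, -⟩ := hScheme
    have hV := EntropyAux.measurable_messagesBelow hW M
    exact Finset.sum_le_sum fun n _ => EntropyAux.condH_le_entH (hA _ n) (by fun_prop)
  have hsum : ∑ i ∈ Finset.range (K - M), (1 / (N : ℝ)) ^ i ≤ (K : ℝ) - M := by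
    rw [← Nat.cast_sub hMK.le]
    refine (Finset.sum_le_card_nsmul _ _ 1 fun i _ => pow_le_one₀ (by positivity) ?_).trans
      (by simp)
    exact div_le_one_of_le₀ (by exact_mod_cast (by omega : 1 ≤ N)) (by positivity)
  refine ⟨?_, ?_⟩
  · nlinarith [mul_le_mul_of_nonneg_right hsum hε]
  · rintro rfl
    rw [ge_iff_le, le_div_iff₀ hℓ]
    linarith
end

section
/- Capacity of PIR with partially known private side information (Theorem 1, zero-error form): Let S ⊆ ℝ be the set of all normalized download costs D/ℓ over all perfectly reliable schemes, where D = max_{k ∈ {M+1,…,K}} Σ_{n=1}^N H(A_n^[k]). Assume N | M and M ≥ 0. Then the infimum of S equals Σ_{i=0}^{K−M−1} (1/N)^i = (1 − (1/N)^{K−M})/(1 − 1/N), and this infimum is attained; equivalently, the capacity equals C = (1 − 1/N)/(1 − (1/N)^{K−M}). -/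
open MeasureTheory

/-- `x` is an achievable normalized download cost for PIR with partially known private side
information (parameters `N, K, M`): there is a perfectly reliable scheme (`ε = 0`) with
message entropy `ℓ > 0` such that `x = D/ℓ`, where the download cost is the worst case
over desired messages, `D = max_{k ∈ {M+1,…,K}} ∑ₙ H(Aₙ^[k])` (here realized as a supremum
over the 0-indexed desired indices `k : Fin K` with `M ≤ k`). -/
def AchievableNormCost (N K M : ℕ) (x : ℝ) : Prop :=
  ∃ (Ω : Type) (_ : MeasurableSpace Ω) (μ : Measure Ω)
    (S T U : Type) (_ : Fintype S) (_ : Fintype T) (_ : Fintype U)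
    (_ : MeasurableSpace S) (_ : MeasurableSpace T) (_ : MeasurableSpace U)
    (_ : MeasurableSingletonClass S) (_ : MeasurableSingletonClass T)
    (_ : MeasurableSingletonClass U)
    (W : Fin K → Ω → S) (Q : Fin K → Fin N → Ω → T) (A : Fin K → Fin N → Ω → U)
    (ℓ : ℝ), 0 < ℓ ∧
    SchemeHyps N K M μ W Q A ℓ 0 ∧
    x = (⨆ k : {k : Fin K // M ≤ (k : ℕ)}, ∑ n : Fin N, entH μ (A k.1 n)) / ℓ

section FiniteEntropy

variable {E S T U : Type*} [Fintype E]

open Classical in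
/-- The mass that the weight `p` gives to the fibre of `f` over `s`. -/
noncomputable def marg (p : E → ℝ) (f : E → S) (s : S) : ℝ :=
  ∑ e with f e = s, p e

theorem marg_nonneg {p : E → ℝ} (hp : ∀ e, 0 ≤ p e) (f : E → S) (s : S) : 0 ≤ marg p f s :=
  Finset.sum_nonneg fun e _ => hp e

theorem le_marg {p : E → ℝ} (hp : ∀ e, 0 ≤ p e) (f : E → S) (e : E) : p e ≤ marg p f (f e) := by
  classical
  unfold marg
  exact Finset.single_le_sum (f := p) (fun i _ => hp i) (by simp)

theorem sum_marg_prod [Fintype S] (p : E → ℝ) (f : E → S) (g : E → T) (t : T) :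
    ∑ s, marg p (fun e => (f e, g e)) (s, t) = marg p g t := by
  classical
  unfold marg
  rw [← Finset.sum_fiberwise (Finset.univ.filter fun e => g e = t) f]
  refine Finset.sum_congr rfl fun s _ => ?_
  refine Finset.sum_congr ?_ fun _ _ => rfl
  ext e
  simp [Prod.ext_iff, and_comm]

variable [Fintype S] [Fintype T] [Fintype U]

/-- The entropy of `f` under the weight `p` on a finite type. -/
noncomputable def finEnt (p : E → ℝ) (f : E → S) : ℝ :=
  ∑ s, Real.negMulLog (marg p f s)

theorem sum_mul_comp (p : E → ℝ) (f : E → S) (g : S → ℝ) :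
    ∑ e, p e * g (f e) = ∑ s, marg p f s * g s := by
  classical
  rw [← Finset.sum_fiberwise Finset.univ f]
  refine Finset.sum_congr rfl fun s _ => ?_
  unfold marg
  rw [Finset.sum_mul]
  refine Finset.sum_congr (by congr) fun e he => ?_
  rw [(Finset.mem_filter.1 he).2]

theorem sum_marg (p : E → ℝ) (f : E → S) : ∑ s, marg p f s = ∑ e, p e := by
  simpa using (sum_mul_comp p f fun _ => 1).symm

theorem finEnt_eq_neg_sum (p : E → ℝ) (f : E → S) :
    finEnt p f = -∑ e, p e * Real.log (marg p f (f e)) := by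
  rw [sum_mul_comp p f fun s => Real.log (marg p f s), ← Finset.sum_neg_distrib]
  simp [finEnt, Real.negMulLog]

/-- Entropy does not increase when passing to a function of `f`. -/
theorem finEnt_mono {p : E → ℝ} (hp : ∀ e, 0 ≤ p e) {f : E → S} {g : E → T}
    (h : ∀ e e', f e = f e' → g e = g e') : finEnt p g ≤ finEnt p f := by
  classical
  rw [finEnt_eq_neg_sum, finEnt_eq_neg_sum]
  refine neg_le_neg (Finset.sum_le_sum fun e _ => ?_)
  rcases (hp e).eq_or_lt with h0 | h0
  · simp [← h0]
  · refine mul_le_mul_of_nonneg_left (Real.log_le_log (h0.trans_le (le_marg hp f e)) ?_) (hp e)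
    unfold marg
    refine Finset.sum_le_sum_of_subset_of_nonneg (fun x hx => ?_) fun i _ _ => hp i
    simp only [Finset.mem_filter, Finset.mem_univ, true_and] at hx ⊢
    exact h _ _ hx

theorem finEnt_congr {p : E → ℝ} (hp : ∀ e, 0 ≤ p e) {f : E → S} {g : E → T}
    (h : ∀ e e', f e = f e' ↔ g e = g e') : finEnt p g = finEnt p f :=
  le_antisymm (finEnt_mono hp fun e e' => (h e e').1) (finEnt_mono hp fun e e' => (h e e').2)

theorem finEnt_unit {p : E → ℝ} (hp1 : ∑ e, p e = 1) : finEnt p (fun _ => ()) = 0 := by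
  simp [finEnt, marg, hp1]

/-- Submodularity of entropy. -/
theorem finEnt_submodular {p : E → ℝ} (hp : ∀ e, 0 ≤ p e) (X : E → S) (Y : E → T) (Z : E → U) :
    finEnt p (fun e => (X e, Y e, Z e)) + finEnt p Z ≤
      finEnt p (fun e => (X e, Z e)) + finEnt p (fun e => (Y e, Z e)) := by
  set a := marg p (fun e => (X e, Y e, Z e)) with ha
  set b := marg p (fun e => (X e, Z e)) with hb
  set c := marg p (fun e => (Y e, Z e)) with hc
  set d := marg p Z with hd
  have hb0 : ∀ x, 0 ≤ b x := marg_nonneg hp _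
  have hc0 : ∀ x, 0 ≤ c x := marg_nonneg hp _
  have hd0 : ∀ x, 0 ≤ d x := marg_nonneg hp _
  have ha0 : ∀ x, 0 ≤ a x := marg_nonneg hp _
  let r : S × T × U → ℝ := fun v => b (v.1, v.2.2) * c v.2 / (a v * d v.2.2)
  have key : ∑ e, p e * (1 - r (X e, Y e, Z e)) ≤
      ∑ e, p e * (Real.log (a (X e, Y e, Z e)) + Real.log (d (Z e))
        - Real.log (b (X e, Z e)) - Real.log (c (Y e, Z e))) := by
    refine Finset.sum_le_sum fun e _ => ?_
    rcases (hp e).eq_or_lt with h0 | h0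
    · simp [← h0]
    · have h1 : 0 < a (X e, Y e, Z e) :=
        h0.trans_le (le_marg hp (fun e => (X e, Y e, Z e)) e)
      have h2 : 0 < b (X e, Z e) := h0.trans_le (le_marg hp (fun e => (X e, Z e)) e)
      have h3 : 0 < c (Y e, Z e) := h0.trans_le (le_marg hp (fun e => (Y e, Z e)) e)
      have h4 : 0 < d (Z e) := h0.trans_le (le_marg hp Z e)
      refine mul_le_mul_of_nonneg_left ?_ (hp e)
      have := Real.log_le_sub_one_of_pos
        (show 0 < r (X e, Y e, Z e) from div_pos (mul_pos h2 h3) (mul_pos h1 h4))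
      have hl : Real.log (r (X e, Y e, Z e)) = Real.log (b (X e, Z e)) + Real.log (c (Y e, Z e))
          - (Real.log (a (X e, Y e, Z e)) + Real.log (d (Z e))) := by
        simp only [r]
        rw [Real.log_div (mul_pos h2 h3).ne' (mul_pos h1 h4).ne',
          Real.log_mul h2.ne' h3.ne', Real.log_mul h1.ne' h4.ne']
      linarith
  have hr : ∑ e, p e * r (X e, Y e, Z e) ≤ ∑ e, p e := by
    rw [sum_mul_comp p (fun e => (X e, Y e, Z e)) r]
    calc ∑ v, a v * r v ≤ ∑ v : S × T × U, b (v.1, v.2.2) * c v.2 / d v.2.2 := by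
          refine Finset.sum_le_sum fun v _ => ?_
          rcases (ha0 v).eq_or_lt with h | h
          · rw [← h, zero_mul]
            exact div_nonneg (mul_nonneg (hb0 _) (hc0 _)) (hd0 _)
          · apply le_of_eq
            simp only [r]
            rw [← div_div, mul_div_assoc', mul_div_cancel₀ _ h.ne']
      _ = ∑ z, d z * d z / d z := by
          rw [Fintype.sum_prod_type]
          simp_rw [Fintype.sum_prod_type_right]
          rw [Finset.sum_comm]
          refine Finset.sum_congr rfl fun z _ => ?_
          simp_rw [mul_div_assoc, ← Finset.mul_sum, ← Finset.sum_mul, ← Finset.sum_div]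
          rw [hb, hc, hd, sum_marg_prod, sum_marg_prod]
      _ ≤ ∑ z, d z := Finset.sum_le_sum fun z _ => by
          rcases (hd0 z).eq_or_lt with h | h
          · simp [← h]
          · rw [mul_div_cancel_right₀ _ h.ne']
      _ = ∑ e, p e := sum_marg p Z
  have e1 : ∑ e, p e * (1 - r (X e, Y e, Z e)) = ∑ e, p e - ∑ e, p e * r (X e, Y e, Z e) := by
    simp_rw [mul_sub, mul_one, Finset.sum_sub_distrib]
  simp only [finEnt_eq_neg_sum]
  simp_rw [mul_sub, mul_add, mul_one, Finset.sum_sub_distrib, Finset.sum_add_distrib] at key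
  linarith

theorem finEnt_prod_le {p : E → ℝ} (hp : ∀ e, 0 ≤ p e) (hp1 : ∑ e, p e = 1)
    (X : E → S) (Y : E → T) :
    finEnt p (fun e => (X e, Y e)) ≤ finEnt p X + finEnt p Y := by
  have h := finEnt_submodular hp X Y (fun _ => ())
  rw [finEnt_unit hp1] at h
  have h1 : finEnt p (fun e => (X e, ())) = finEnt p X := finEnt_congr hp (by simp)
  have h2 : finEnt p (fun e => (Y e, ())) = finEnt p Y := finEnt_congr hp (by simp)
  have h3 : finEnt p (fun e => (X e, Y e, ())) = finEnt p (fun e => (X e, Y e)) :=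
    finEnt_congr hp (by simp)
  linarith

/-- Additivity of entropy for independent variables. -/
theorem finEnt_of_product {p : E → ℝ} (hp : ∀ e, 0 ≤ p e) {ι : Type*} [Fintype ι] [DecidableEq ι]
    (X : E → S) (Y : ι → E → T)
    (h : ∀ e, marg p (fun e => (X e, fun i => Y i e)) (X e, fun i => Y i e) =
      marg p X (X e) * ∏ i, marg p (Y i) (Y i e)) :
    finEnt p (fun e => (X e, fun i => Y i e)) = finEnt p X + ∑ i, finEnt p (Y i) := by
  simp only [finEnt_eq_neg_sum]
  rw [Finset.sum_neg_distrib, ← neg_add, Finset.sum_comm, ← Finset.sum_add_distrib]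
  congr 1
  refine Finset.sum_congr rfl fun e _ => ?_
  rcases (hp e).eq_or_lt with h0 | h0
  · simp [← h0]
  · rw [h e, Real.log_mul (h0.trans_le (le_marg hp X e)).ne'
      (Finset.prod_ne_zero_iff.2 fun i _ => (h0.trans_le (le_marg hp (Y i) e)).ne'),
      Real.log_prod fun i _ => (h0.trans_le (le_marg hp (Y i) e)).ne', mul_add, Finset.mul_sum]

end FiniteEntropy

section Converse

/-- The tuple of the messages with index below `m`. -/
def firstMsgs {Ω S : Type*} {K : ℕ} (w : Fin K → Ω → S) (m : ℕ) (ω : Ω) :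
    {i : Fin K // (i : ℕ) < m} → S :=
  fun i => w i.1 ω

theorem firstMsgs_eq_iff {Ω S : Type*} {K : ℕ} {w : Fin K → Ω → S} {m : ℕ} {ω ω' : Ω} :
    firstMsgs w m ω = firstMsgs w m ω' ↔ ∀ i : Fin K, (i : ℕ) < m → w i ω = w i ω' := by
  simp [firstMsgs, funext_iff]

variable {E S T U : Type*} [Fintype E] [Fintype S] [Fintype T] [Fintype U] {N K M : ℕ}
  {p : E → ℝ} {w : Fin K → E → S} {q : Fin N → E → T} {a : Fin N → E → U} {ℓ : ℝ}

/-- The conditional entropy of the `n`-th answer given its query and the first `m` messages. -/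
noncomputable def answerEnt (p : E → ℝ) (w : Fin K → E → S) (q : Fin N → E → T)
    (a : Fin N → E → U) (m : ℕ) (n : Fin N) : ℝ :=
  finEnt p (fun e => (a n e, q n e, firstMsgs w m e)) -
    finEnt p (fun e => (q n e, firstMsgs w m e))

theorem answerEnt_nonneg (hp : ∀ e, 0 ≤ p e) (m : ℕ) (n : Fin N) :
    0 ≤ answerEnt p w q a m n :=
  sub_nonneg.2 (finEnt_mono hp (by simp +contextual))

theorem answerEnt_le (hp : ∀ e, 0 ≤ p e) (hp1 : ∑ e, p e = 1) (m : ℕ) (n : Fin N) :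
    answerEnt p w q a m n ≤ finEnt p (a n) :=
  sub_le_iff_le_add.2 (finEnt_prod_le hp hp1 _ _)

theorem finEnt_firstMsgs_succ {V : Type*} [Fintype V] (hp : ∀ e, 0 ≤ p e) (X : E → V)
    (k : Fin K) :
    finEnt p (fun e => (X e, firstMsgs w (k + 1) e)) =
      finEnt p (fun e => (w k e, X e, firstMsgs w k e)) := by
  refine finEnt_congr hp fun e e' => ?_
  simp only [Prod.mk.injEq, firstMsgs_eq_iff]
  constructor
  · rintro ⟨h1, h2, h3⟩
    refine ⟨h2, fun i hi => ?_⟩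
    rcases Nat.lt_succ_iff_lt_or_eq.1 hi with h | h
    · exact h3 i h
    · rwa [Fin.ext h]
  · rintro ⟨h1, h2⟩
    exact ⟨h2 k (by omega), h1, fun i hi => h2 i (by omega)⟩

/-- A variable independent of all the messages is independent of the first `m` of them. -/
theorem finEnt_prod_firstMsgs {V : Type*} [Fintype V] (hp : ∀ e, 0 ≤ p e)
    (hp1 : ∑ e, p e = 1) (hw : ∀ i, finEnt p (w i) = ℓ) (X : E → V)
    (hX : finEnt p X + K * ℓ ≤ finEnt p (fun e => (X e, fun i => w i e))) {m : ℕ} (hm : m ≤ K) :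
    finEnt p (fun e => (X e, firstMsgs w m e)) = finEnt p X + m * ℓ := by
  have step : ∀ m < K, finEnt p (fun e => (X e, firstMsgs w (m + 1) e)) ≤
      finEnt p (fun e => (X e, firstMsgs w m e)) + ℓ := fun m hm => by
    have h := finEnt_firstMsgs_succ (w := w) hp X ⟨m, hm⟩
    have h' := finEnt_prod_le hp hp1 (w ⟨m, hm⟩) (fun e => (X e, firstMsgs w m e))
    rw [hw] at h'
    simp only at h
    linarith
  have h0 : finEnt p (fun e => (X e, firstMsgs w 0 e)) = finEnt p X :=
    finEnt_congr hp (by simp [firstMsgs_eq_iff])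
  have hK : finEnt p (fun e => (X e, firstMsgs w K e)) =
      finEnt p (fun e => (X e, fun i => w i e)) :=
    finEnt_congr hp (by simp [firstMsgs, funext_iff])
  have up : ∀ m ≤ K, finEnt p (fun e => (X e, firstMsgs w m e)) ≤ finEnt p X + m * ℓ := by
    intro m
    induction m with
    | zero => intro _; simp [h0]
    | succ m ih =>
      intro h
      have := step m h
      have := ih (by omega)
      push_cast
      linarith
  have down : ∀ j ≤ K, finEnt p X + ((K - j : ℕ) : ℝ) * ℓ ≤
      finEnt p (fun e => (X e, firstMsgs w (K - j) e)) := by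
    intro j
    induction j with
    | zero => intro _; simpa [hK] using hX
    | succ j ih =>
      intro h
      have h1 := step (K - (j + 1)) (by omega)
      have h2 := ih (by omega)
      rw [show K - j = K - (j + 1) + 1 by omega] at h2
      push_cast at h2
      linarith
  refine le_antisymm (up m hm) ?_
  have := down (K - m) (by omega)
  rwa [Nat.sub_sub_self hm] at this

/-- Subadditivity: the answers are jointly no more uncertain than one by one. -/
theorem finEnt_answers_le (hp : ∀ e, 0 ≤ p e) (m : ℕ) :
    finEnt p (fun e => (fun n => a n e, fun n => q n e, firstMsgs w m e)) ≤
      finEnt p (fun e => (fun n => q n e, firstMsgs w m e)) + ∑ n, answerEnt p w q a m n := by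
  have key : ∀ s : Finset (Fin N),
      finEnt p (fun e => (fun n : s => a n e, fun n => q n e, firstMsgs w m e)) ≤
        finEnt p (fun e => (fun n => q n e, firstMsgs w m e)) +
          ∑ n ∈ s, answerEnt p w q a m n := by
    intro s
    induction s using Finset.induction_on with
    | empty =>
      rw [Finset.sum_empty, add_zero]
      exact finEnt_mono hp (by simp [funext_iff])
    | insert n s hn ih =>
      have h := finEnt_submodular hp (a n)
        (fun e => (fun n : s => a n e, fun n => q n e, firstMsgs w m e))
        (fun e => (q n e, firstMsgs w m e))
      have h1 : finEnt p (fun e => (fun n : (insert n s : Finset (Fin N)) => a n e,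
          fun n => q n e, firstMsgs w m e)) ≤ finEnt p (fun e => (a n e,
          (fun n : s => a n e, fun n => q n e, firstMsgs w m e),
          (q n e, firstMsgs w m e))) := by
        refine finEnt_mono hp fun e e' => ?_
        simp only [Prod.mk.injEq, funext_iff, Subtype.forall, Finset.mem_insert]
        rintro ⟨h1, ⟨h2, h3, h4⟩, -, -⟩
        refine ⟨?_, h3, h4⟩
        rintro i (rfl | hi)
        · exact h1
        · exact h2 i hi
      have h2 : finEnt p (fun e => ((fun n : s => a n e, fun n => q n e, firstMsgs w m e),
          (q n e, firstMsgs w m e))) ≤ finEnt p (fun e => (fun n : s => a n e, fun n => q n e,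
            firstMsgs w m e)) := by
        refine finEnt_mono hp fun e e' => ?_
        simp only [Prod.mk.injEq]
        rintro ⟨h2, h3, h4⟩
        exact ⟨⟨h2, h3, h4⟩, congrFun h3 n, h4⟩
      rw [Finset.sum_insert hn]
      unfold answerEnt at ih ⊢
      linarith
  refine le_trans (finEnt_mono hp fun e e' => ?_) (key Finset.univ)
  simp [funext_iff]

/-- The information retrieved by a scheme for message `k` beyond the message itself is at least
the average uncertainty of the answers given the first `k + 1` messages. -/
theorem answerEnt_recursion (hN : 0 < N) (hp : ∀ e, 0 ≤ p e) (hp1 : ∑ e, p e = 1)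
    (hw : ∀ i, finEnt p (w i) = ℓ)
    (hind : finEnt p (fun e => (fun n => q n e, fun i => w i e)) =
      finEnt p (fun e n => q n e) + K * ℓ)
    (hdet : ∀ n, finEnt p (fun e => (a n e, q n e, fun i => w i e)) ≤
      finEnt p (fun e => (q n e, fun i => w i e)))
    (k : Fin K) (hk : M ≤ k)
    (hdec : finEnt p (fun e => (w k e, fun n => q n e, fun n => a n e, firstMsgs w M e)) ≤
      finEnt p (fun e => (fun n => q n e, fun n => a n e, firstMsgs w M e))) :
    ℓ + 1 / N * ∑ n, answerEnt p w q a (k + 1) n ≤ ∑ n, answerEnt p w q a k n := by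
  have hqn : ∀ n, finEnt p (q n) + K * ℓ ≤ finEnt p (fun e => (q n e, fun i => w i e)) := by
    intro n
    have h := finEnt_submodular hp (fun e i => w i e) (fun e n => q n e) (q n)
    have h1 : finEnt p (fun e => (fun i => w i e, fun n => q n e, q n e)) =
        finEnt p (fun e => (fun n => q n e, fun i => w i e)) := by
      refine finEnt_congr hp fun e e' => ?_
      simp only [Prod.mk.injEq]
      exact ⟨fun ⟨h1, h2⟩ => ⟨h2, h1, congrFun h1 n⟩, fun ⟨h1, h2, _⟩ => ⟨h2, h1⟩⟩
    have h2 : finEnt p (fun e => (fun n => q n e, q n e)) = finEnt p (fun e n => q n e) := by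
      refine finEnt_congr hp fun e e' => ?_
      simp only [Prod.mk.injEq]
      exact ⟨fun h => ⟨h, congrFun h n⟩, fun h => h.1⟩
    have h3 : finEnt p (fun e => (fun i => w i e, q n e)) =
        finEnt p (fun e => (q n e, fun i => w i e)) :=
      finEnt_congr hp (by simp [and_comm])
    linarith
  have hqV : ∀ m ≤ K, finEnt p (fun e => (fun n => q n e, firstMsgs w m e)) =
      finEnt p (fun e n => q n e) + m * ℓ :=
    fun m hm => finEnt_prod_firstMsgs hp hp1 hw _ hind.ge hm
  have hqnV : ∀ n, ∀ m ≤ K, finEnt p (fun e => (q n e, firstMsgs w m e)) =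
      finEnt p (q n) + m * ℓ :=
    fun n m hm => finEnt_prod_firstMsgs hp hp1 hw _ (hqn n) hm
  have hdecode : finEnt p (fun e => (fun n => a n e, fun n => q n e, firstMsgs w (k + 1) e)) ≤
      finEnt p (fun e => (fun n => a n e, fun n => q n e, firstMsgs w k e)) := by
    have h := finEnt_submodular hp (w k) (firstMsgs w k)
      (fun e => (fun n => q n e, fun n => a n e, firstMsgs w M e))
    have h1 : finEnt p (fun e => (fun n => a n e, fun n => q n e, firstMsgs w (k + 1) e)) ≤
        finEnt p (fun e => (w k e, firstMsgs w k e,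
          fun n => q n e, fun n => a n e, firstMsgs w M e)) := by
      refine finEnt_mono hp fun e e' => ?_
      simp only [Prod.mk.injEq, firstMsgs_eq_iff]
      rintro ⟨h1, h2, h3, h4, -⟩
      refine ⟨h4, h3, fun i hi => ?_⟩
      rcases Nat.lt_succ_iff_lt_or_eq.1 hi with h | h
      · exact h2 i h
      · rwa [Fin.ext h]
    have h2 : finEnt p (fun e => (firstMsgs w k e,
        fun n => q n e, fun n => a n e, firstMsgs w M e)) ≤
        finEnt p (fun e => (fun n => a n e, fun n => q n e, firstMsgs w k e)) := by
      refine finEnt_mono hp fun e e' => ?_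
      simp only [Prod.mk.injEq, firstMsgs_eq_iff]
      rintro ⟨h1, h2, h3⟩
      exact ⟨h3, h2, h1, fun i hi => h3 i (by omega)⟩
    linarith
  have hone : ∀ n, answerEnt p w q a (k + 1) n ≤
      finEnt p (fun e => (fun n => a n e, fun n => q n e, firstMsgs w (k + 1) e)) -
        finEnt p (fun e => (fun n => q n e, firstMsgs w (k + 1) e)) := by
    intro n
    have h := finEnt_submodular hp (fun e i => w i e) (fun e n => q n e)
      (fun e => (a n e, q n e, firstMsgs w (k + 1) e))
    have h1 : finEnt p (fun e => (fun n => q n e, fun i => w i e)) ≤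
        finEnt p (fun e => (fun i => w i e, fun n => q n e,
          a n e, q n e, firstMsgs w (k + 1) e)) :=
      finEnt_mono hp (by simp +contextual)
    have h2 : finEnt p (fun e => (fun i => w i e, a n e, q n e, firstMsgs w (k + 1) e)) ≤
        finEnt p (fun e => (a n e, q n e, fun i => w i e)) := by
      refine finEnt_mono hp fun e e' => ?_
      simp only [Prod.mk.injEq, firstMsgs_eq_iff]
      rintro ⟨h1, h2, h3⟩
      exact ⟨h3, h1, h2, fun i _ => congrFun h3 i⟩
    have h3 : finEnt p (fun e => (fun n => q n e, a n e, q n e, firstMsgs w (k + 1) e)) ≤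
        finEnt p (fun e => (fun n => a n e, fun n => q n e, firstMsgs w (k + 1) e)) := by
      refine finEnt_mono hp fun e e' => ?_
      simp only [Prod.mk.injEq]
      rintro ⟨h1, h2, h3⟩
      exact ⟨h2, congrFun h1 n, congrFun h2 n, h3⟩
    have h4 := hdet n
    have h5 : finEnt p (fun e => (q n e, fun i => w i e)) ≤ finEnt p (q n) + K * ℓ := by
      rw [← hqnV n K le_rfl]
      exact finEnt_mono hp (by simp [firstMsgs, funext_iff])
    have h6 := hqV (k + 1) k.2
    have h7 := hqnV n (k + 1) k.2
    unfold answerEnt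
    linarith
  have hsum : 1 / N * ∑ n, answerEnt p w q a (k + 1) n ≤
      finEnt p (fun e => (fun n => a n e, fun n => q n e, firstMsgs w (k + 1) e)) -
        finEnt p (fun e => (fun n => q n e, firstMsgs w (k + 1) e)) := by
    have h := Finset.sum_le_sum fun n (_ : n ∈ Finset.univ) => hone n
    rw [Finset.sum_const, Finset.card_univ, Fintype.card_fin, nsmul_eq_mul] at h
    have hN' : (0 : ℝ) < N := by exact_mod_cast hN
    rw [one_div_mul_eq_div, div_le_iff₀' hN']
    exact h
  have hall := finEnt_answers_le (a := a) (q := q) (w := w) hp k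
  have h1 := hqV (k + 1) k.2
  have h2 := hqV k k.2.le
  push_cast at h1
  linarith

end Converse

section MeasureTranslation

variable {Ω E S : Type*} [MeasurableSpace Ω] [Fintype E] [MeasurableSpace E]
  [MeasurableSingletonClass E] (μ : Measure Ω) [IsProbabilityMeasure μ] {Z : Ω → E}

theorem marg_measureReal (hZ : Measurable Z) (f : E → S) (s : S) :
    marg (fun e => μ.real (Z ⁻¹' {e})) f s = μ.real ((fun ω => f (Z ω)) ⁻¹' {s}) := by
  classical
  unfold marg
  rw [← measureReal_biUnion_finset]
  · congr 1
    ext ω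
    simp
  · intro e _ e' _ h
    exact Disjoint.preimage _ (by simpa using h)
  · exact fun e _ => hZ (measurableSet_singleton e)

theorem entH_comp [Fintype S] (hZ : Measurable Z) (f : E → S) :
    entH μ (fun ω => f (Z ω)) = finEnt (fun e => μ.real (Z ⁻¹' {e})) f := by
  unfold entH finEnt
  simp_rw [marg_measureReal μ hZ]
  rfl

theorem sum_measureReal_fiber (hZ : Measurable Z) : ∑ e, μ.real (Z ⁻¹' {e}) = 1 := by
  have h := marg_measureReal μ hZ (fun _ => ()) ()
  simpa [marg] using h

end MeasureTranslation

section LowerBound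

variable {N K M : ℕ} {Ω : Type*} [MeasurableSpace Ω] {μ : Measure Ω} {S T U : Type*}
  [Fintype S] [Fintype T] [Fintype U]
  [MeasurableSpace S] [MeasurableSpace T] [MeasurableSpace U]
  [MeasurableSingletonClass S] [MeasurableSingletonClass T] [MeasurableSingletonClass U]
  {W : Fin K → Ω → S} {Q : Fin K → Fin N → Ω → T} {A : Fin K → Fin N → Ω → U} {ℓ : ℝ}

/-- The conditional entropy of the `n`-th answer for message `k`, given its query and the first
`m` messages. -/
noncomputable def schemeAnswerEnt (μ : Measure Ω) (W : Fin K → Ω → S)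
    (Q : Fin K → Fin N → Ω → T) (A : Fin K → Fin N → Ω → U) (k : Fin K) (m : ℕ) (n : Fin N) : ℝ :=
  condH μ (A k n) (fun ω => (Q k n ω, firstMsgs W m ω))

theorem schemeAnswerEnt_congr (h : SchemeHyps N K M μ W Q A ℓ 0) {k k' : Fin K}
    (hk : M ≤ (k : ℕ)) (hk' : M ≤ (k' : ℕ)) (m : ℕ) (n : Fin N) :
    schemeAnswerEnt μ W Q A k m n = schemeAnswerEnt μ W Q A k' m n := by
  obtain ⟨hμ, hWm, hQm, hAm, -, -, -, -, hpriv, -⟩ := h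
  let Z : Fin K → Ω → T × U × (Fin K → S) := fun k ω => (Q k n ω, A k n ω, fun i => W i ω)
  have hZ : ∀ k, Measurable (Z k) := fun k =>
    (hQm k n).prodMk ((hAm k n).prodMk (measurable_pi_lambda _ hWm))
  have hp : (fun e => μ.real (Z k ⁻¹' {e})) = fun e => μ.real (Z k' ⁻¹' {e}) := by
    funext ⟨t, u, w⟩
    have := hpriv n k k' hk hk' t u w
    simpa [Z, Measure.real, Set.preimage, funext_iff] using congrArg ENNReal.toReal this
  let π : Fin K → T × U × (Fin K → S) → S := fun i e => e.2.2 i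
  have e1 : ∀ k, entH μ (fun ω => (A k n ω, Q k n ω, firstMsgs W m ω)) =
      finEnt (fun e => μ.real (Z k ⁻¹' {e})) (fun e => (e.2.1, e.1, firstMsgs π m e)) :=
    fun k => entH_comp μ (hZ k) fun e => (e.2.1, e.1, firstMsgs π m e)
  have e2 : ∀ k, entH μ (fun ω => (Q k n ω, firstMsgs W m ω)) =
      finEnt (fun e => μ.real (Z k ⁻¹' {e})) (fun e => (e.1, firstMsgs π m e)) :=
    fun k => entH_comp μ (hZ k) fun e => (e.1, firstMsgs π m e)
  unfold schemeAnswerEnt condH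
  rw [e1, e1, e2, e2, hp]

theorem schemeAnswerEnt_bounds (hN : 0 < N) (h : SchemeHyps N K M μ W Q A ℓ 0) {k : Fin K}
    (hk : M ≤ (k : ℕ)) :
    (∀ m n, 0 ≤ schemeAnswerEnt μ W Q A k m n) ∧
    (∀ m n, schemeAnswerEnt μ W Q A k m n ≤ entH μ (A k n)) ∧
    ℓ + 1 / N * ∑ n, schemeAnswerEnt μ W Q A k (k + 1) n ≤
      ∑ n, schemeAnswerEnt μ W Q A k k n := by
  obtain ⟨hμ, hWm, hQm, hAm, hWℓ, hWind, hQind, hdet, -, hdec⟩ := h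
  let Z : Ω → (Fin N → T) × (Fin N → U) × (Fin K → S) :=
    fun ω => (fun n => Q k n ω, fun n => A k n ω, fun i => W i ω)
  have hZ : Measurable Z := (measurable_pi_lambda _ (hQm k)).prodMk
    ((measurable_pi_lambda _ (hAm k)).prodMk (measurable_pi_lambda _ hWm))
  let p := fun e => μ.real (Z ⁻¹' {e})
  let q : Fin N → (Fin N → T) × (Fin N → U) × (Fin K → S) → T := fun n e => e.1 n
  let a : Fin N → (Fin N → T) × (Fin N → U) × (Fin K → S) → U := fun n e => e.2.1 n
  let w : Fin K → (Fin N → T) × (Fin N → U) × (Fin K → S) → S := fun i e => e.2.2 i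
  have hp : ∀ e, 0 ≤ p e := fun e => measureReal_nonneg
  have hp1 : ∑ e, p e = 1 := sum_measureReal_fiber μ hZ
  have hs : ∀ m n, schemeAnswerEnt μ W Q A k m n = answerEnt p w q a m n := fun m n =>
    congrArg₂ (· - ·) (entH_comp μ hZ fun e => (a n e, q n e, firstMsgs w m e))
      (entH_comp μ hZ fun e => (q n e, firstMsgs w m e))
  have ha : ∀ n, entH μ (A k n) = finEnt p (a n) := fun n => entH_comp μ hZ (a n)
  have hw : ∀ i, finEnt p (w i) = ℓ := fun i => (entH_comp μ hZ (w i)).symm.trans (hWℓ i)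
  simp_rw [hs, ha]
  refine ⟨answerEnt_nonneg hp, answerEnt_le hp hp1, ?_⟩
  refine answerEnt_recursion (M := M) hN hp hp1 hw ?_ ?_ k hk ?_
  · rw [finEnt_of_product hp (fun e n => q n e) w]
    · simp [hw]
    · rintro ⟨t, u, v⟩
      simp only [p]
      simp_rw [marg_measureReal μ hZ]
      have h1 := hQind k hk t v
      rw [hWind v] at h1
      have h2 := congrArg ENNReal.toReal h1
      rw [ENNReal.toReal_mul, ENNReal.toReal_prod] at h2
      simpa [Z, q, w, Measure.real, Set.preimage, funext_iff] using h2
  · intro n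
    have h1 := hdet k hk n
    refine le_of_eq ?_
    refine (entH_comp μ hZ fun e => (a n e, q n e, fun i => w i e)).symm.trans ?_
    refine Eq.trans ?_ (entH_comp μ hZ fun e => (q n e, fun i => w i e))
    exact sub_eq_zero.1 h1
  · have h1 := hdec k hk
    refine (entH_comp μ hZ fun e =>
      (w k e, fun n => q n e, fun n => a n e, firstMsgs w M e)).symm.trans_le ?_
    refine le_trans ?_ (entH_comp μ hZ fun e =>
      (fun n => q n e, fun n => a n e, firstMsgs w M e)).le
    exact sub_nonpos.1 h1

theorem le_sum_entH_answers (hN : 0 < N) (h : SchemeHyps N K M μ W Q A ℓ 0) {k : Fin K}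
    (hk : (k : ℕ) = M) :
    ℓ * ∑ i ∈ Finset.range (K - M), (1 / (N : ℝ)) ^ i ≤ ∑ n, entH μ (A k n) := by
  have hb := schemeAnswerEnt_bounds hN h hk.ge
  have step : ∀ m, M ≤ m → m < K → ℓ + 1 / N * ∑ n, schemeAnswerEnt μ W Q A k (m + 1) n ≤
      ∑ n, schemeAnswerEnt μ W Q A k m n := fun m hm hmK => by
    have h1 := (schemeAnswerEnt_bounds hN h (k := ⟨m, hmK⟩) hm).2.2
    simp_rw [schemeAnswerEnt_congr h (k := ⟨m, hmK⟩) (k' := k) hm hk.ge] at h1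
    exact h1
  have main : ∀ j ≤ K - M, ℓ * ∑ i ∈ Finset.range j, (1 / (N : ℝ)) ^ i ≤
      ∑ n, schemeAnswerEnt μ W Q A k (K - j) n := by
    intro j
    induction j with
    | zero => intro _; simpa using Finset.sum_nonneg fun n _ => hb.1 K n
    | succ j ih =>
      intro hj
      have h1 := step (K - (j + 1)) (by omega) (by omega)
      rw [show K - (j + 1) + 1 = K - j by omega] at h1
      have h2 := mul_le_mul_of_nonneg_left (ih (by omega)) (show (0 : ℝ) ≤ 1 / N by positivity)
      rw [Finset.sum_range_succ']
      simp_rw [pow_succ', ← Finset.mul_sum]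
      rw [pow_zero]
      linarith
  refine (main (K - M) le_rfl).trans (Finset.sum_le_sum fun n _ => hb.2.1 _ n)

end LowerBound

section UniformMeasure

variable {Ω S : Type*} [Fintype Ω] [Nonempty Ω] [MeasurableSpace Ω] [DiscreteMeasurableSpace Ω]
  [Fintype S]

/-- The uniform probability measure on a finite nonempty type. -/
noncomputable def unifMeasure (Ω : Type*) [Fintype Ω] [Nonempty Ω] [MeasurableSpace Ω] :
    Measure Ω :=
  (PMF.uniformOfFintype Ω).toMeasure

instance : IsProbabilityMeasure (unifMeasure Ω) :=
  PMF.toMeasure.isProbabilityMeasure _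

theorem unifMeasure_preimage (e : Ω ≃ Ω) (s : Set Ω) :
    unifMeasure Ω (e ⁻¹' s) = unifMeasure Ω s := by
  classical
  unfold unifMeasure
  rw [PMF.toMeasure_uniformOfFintype_apply _ (.of_discrete),
    PMF.toMeasure_uniformOfFintype_apply _ (.of_discrete)]
  congr 2
  exact Fintype.card_congr (e.subtypeEquiv fun a => by simp)

/-- If the fibres of `X` inside an event are exchanged by bijections, they all have the same
probability. -/
theorem unifMeasure_fiber (C : Set Ω) (X : Ω → S)
    (h : ∀ s s', ∃ e : Ω ≃ Ω, ∀ ω, (ω ∈ C ∧ X ω = s) ↔ (e ω ∈ C ∧ X (e ω) = s')) (s : S) :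
    unifMeasure Ω {ω | ω ∈ C ∧ X ω = s} = unifMeasure Ω C * (Fintype.card S : ENNReal)⁻¹ := by
  have heq : ∀ s', unifMeasure Ω {ω | ω ∈ C ∧ X ω = s'} =
      unifMeasure Ω {ω | ω ∈ C ∧ X ω = s} := fun s' => by
    obtain ⟨e, he⟩ := h s' s
    rw [← unifMeasure_preimage e {ω | ω ∈ C ∧ X ω = s}]
    exact congrArg _ (Set.ext he)
  have hC : C = ⋃ s', {ω | ω ∈ C ∧ X ω = s'} := by ext; simp
  have hsum : unifMeasure Ω C = Fintype.card S * unifMeasure Ω {ω | ω ∈ C ∧ X ω = s} := by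
    conv_lhs => rw [hC]
    rw [measure_iUnion _ fun _ => .of_discrete, tsum_fintype,
      Finset.sum_congr rfl fun s' _ => heq s']
    · simp
    · intro a b hab
      exact Set.disjoint_left.2 fun ω h1 h2 => hab (h1.2.symm.trans h2.2)
  have hne : (Fintype.card S : ENNReal) ≠ 0 := by
    have : Nonempty S := ⟨s⟩
    simp
  rw [hsum, mul_right_comm, ENNReal.mul_inv_cancel hne (ENNReal.natCast_ne_top _), one_mul]

theorem unifMeasure_fiber_univ (X : Ω → S)
    (h : ∀ s s', ∃ e : Ω ≃ Ω, ∀ ω, X ω = s ↔ X (e ω) = s') (s : S) :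
    unifMeasure Ω {ω | X ω = s} = (Fintype.card S : ENNReal)⁻¹ := by
  have := unifMeasure_fiber Set.univ X (by simpa using h) s
  simpa using this

theorem entH_unifMeasure [Nonempty S] (X : Ω → S)
    (h : ∀ s s', ∃ e : Ω ≃ Ω, ∀ ω, X ω = s ↔ X (e ω) = s') :
    entH (unifMeasure Ω) X = Real.log (Fintype.card S) := by
  have hs : ∀ s, (unifMeasure Ω (X ⁻¹' {s})).toReal = (Fintype.card S : ℝ)⁻¹ := fun s => by
    have := congrArg ENNReal.toReal (unifMeasure_fiber_univ X h s)
    rwa [ENNReal.toReal_inv, ENNReal.toReal_natCast] at this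
  have hne : (Fintype.card S : ℝ) ≠ 0 := by exact_mod_cast Fintype.card_ne_zero
  simp [entH, hs, Real.negMulLog, hne]

/-- A variable that is a function of `Y` has no conditional entropy given `Y`. -/
theorem condH_eq_zero {S T : Type*} {_ : Fintype S} {_ : Fintype T} (X : Ω → S)
    (Y : Ω → T) (h : ∀ ω ω', Y ω = Y ω' → X ω = X ω') :
    condH (unifMeasure Ω) X Y = 0 := by
  unfold condH
  refine sub_eq_zero.2 ((entH_comp (unifMeasure Ω) measurable_id fun ω => (X ω, Y ω)).trans
    (Eq.trans ?_ (entH_comp (unifMeasure Ω) measurable_id Y).symm))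
  refine finEnt_congr (fun _ => measureReal_nonneg) fun ω ω' => ?_
  simp only [Prod.mk.injEq]
  exact ⟨fun h' => ⟨h ω ω' h', h'⟩, fun h' => h'.2⟩

end UniformMeasure

section Scheme

variable {N K M : ℕ} [NeZero N]

/-- Query vectors: one position in `Fin N` for every message that is not cached. -/
abbrev QVec (N K M : ℕ) : Type := {j : Fin K // M ≤ (j : ℕ)} → Fin N

/-- A message: for every block (indexed by query vectors), a bit at every nonzero position. -/
abbrev Msg (N K M : ℕ) [NeZero N] : Type := QVec N K M → {m : Fin N // m ≠ 0} → Fin 2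

/-- An answer: a bit for every nonzero query vector. -/
abbrev Ans (N K M : ℕ) [NeZero N] : Type := {q : QVec N K M // q ≠ 0} → Fin 2

/-- The bit at position `m` of a block, where position `0` always holds the bit `0`. -/
def bitAt (x : {m : Fin N // m ≠ 0} → Fin 2) (m : Fin N) : Fin 2 :=
  if h : m ≠ 0 then x ⟨m, h⟩ else 0

/-- The sample space: the messages and a private key. -/
abbrev KeyedMsgs (N K M : ℕ) [NeZero N] : Type :=
  (Fin K → Msg N K M) × Equiv.Perm (QVec N K M)

/-- The sum over the messages of the bits of block `b` at the positions prescribed by `q`. -/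
def bitSum (w : Fin K → Msg N K M) (b q : QVec N K M) : Fin 2 :=
  ∑ j, bitAt (w j.1 b) (q j)

/-- The answer to a query: a query assigns query vectors to blocks bijectively. -/
def answer (t : Equiv.Perm (QVec N K M)) (w : Fin K → Msg N K M) : Ans N K M :=
  fun q => bitSum w (t.symm q.1) q.1

/-- The vector with entry `n` at the desired message `k` and zero elsewhere. -/
def desiredShift (M : ℕ) (k : Fin K) (n : Fin N) : QVec N K M :=
  fun j => if j.1 = k then n else 0

/-- The query sent to database `n` when message `k` is desired and the private key is `σ`. -/
def query (k : Fin K) (n : Fin N) (σ : Equiv.Perm (QVec N K M)) : Equiv.Perm (QVec N K M) :=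
  σ.trans (Equiv.addRight (desiredShift M k n))

theorem query_injective (k : Fin K) (n : Fin N) :
    Function.Injective (query (M := M) k n) := fun σ τ h => by
  ext1 b
  simpa [query] using congrArg (fun e : Equiv.Perm (QVec N K M) => e b) h

theorem bitAt_add (x y : {m : Fin N // m ≠ 0} → Fin 2) (m : Fin N) :
    bitAt (x + y) m = bitAt x m + bitAt y m := by
  unfold bitAt
  split <;> simp

theorem answer_add (t : Equiv.Perm (QVec N K M)) (w v : Fin K → Msg N K M) :
    answer t (w + v) = answer t w + answer t v := by
  funext q
  simp [answer, bitSum, bitAt_add, Finset.sum_add_distrib]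

theorem exists_answer_eq (t : Equiv.Perm (QVec N K M)) (d : Ans N K M) :
    ∃ w, answer t w = d := by
  classical
  have hj : ∀ q : {q : QVec N K M // q ≠ 0}, ∃ j, q.1 j ≠ 0 := fun q => Function.ne_iff.1 q.2
  choose c hc using hj
  refine ⟨fun i b _ => if h : t b ≠ 0 then (if i = (c ⟨t b, h⟩).1 then d ⟨t b, h⟩ else 0) else 0,
    ?_⟩
  funext q
  unfold answer bitSum
  rw [Finset.sum_eq_single (c q)]
  · simp [bitAt, hc q, q.2]
  · intro j _ hjq
    have : j.1 ≠ (c q).1 := fun h => hjq (Subtype.ext h)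
    simp [bitAt, q.2, this]
  · simp

theorem bitSum_zero (w : Fin K → Msg N K M) (b : QVec N K M) : bitSum w b 0 = 0 := by
  simp [bitSum, bitAt]

theorem bitSum_add_desiredShift (w : Fin K → Msg N K M) (b f : QVec N K M) (k : Fin K)
    (hk : M ≤ (k : ℕ)) (n : Fin N) :
    bitSum w b (f + desiredShift M k n) = bitAt (w k b) (f ⟨k, hk⟩ + n) +
      ∑ j ∈ Finset.univ.erase ⟨k, hk⟩, bitAt (w j.1 b) (f j) := by
  unfold bitSum
  rw [← Finset.add_sum_erase _ _ (Finset.mem_univ ⟨k, hk⟩)]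
  congr 1
  · simp [desiredShift]
  · refine Finset.sum_congr rfl fun j hj => ?_
    have : j.1 ≠ k := fun h => (Finset.mem_erase.1 hj).1 (Subtype.ext h)
    simp [desiredShift, this]

/-- The desired message can be decoded from the queries and the answers. -/
theorem decode (k : Fin K) (hk : M ≤ (k : ℕ)) (σ : Equiv.Perm (QVec N K M))
    (w w' : Fin K → Msg N K M)
    (h : ∀ n, answer (query k n σ) w = answer (query k n σ) w') : w k = w' k := by
  have hsum : ∀ b n, bitSum w b (σ b + desiredShift M k n) =
      bitSum w' b (σ b + desiredShift M k n) := by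
    intro b n
    by_cases h0 : σ b + desiredShift M k n = 0
    · rw [h0, bitSum_zero, bitSum_zero]
    · have h1 := congrFun (h n) ⟨_, h0⟩
      simpa [answer, query] using h1
  simp_rw [bitSum_add_desiredShift _ _ _ k hk] at hsum
  funext b m
  have h1 := hsum b (m.1 - σ b ⟨k, hk⟩)
  have h2 := hsum b (-σ b ⟨k, hk⟩)
  have hzero : ∀ x : {m : Fin N // m ≠ 0} → Fin 2, bitAt x 0 = 0 := fun x => by simp [bitAt]
  rw [add_neg_cancel, hzero, hzero, zero_add, zero_add] at h2
  rw [h2] at h1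
  simpa [bitAt, m.2] using h1

/-- Translating the messages by an amount that may depend on the key. -/
def translateFst {B C : Type*} [AddGroup B] (c : C → B) : B × C ≃ B × C where
  toFun x := (x.1 + c x.2, x.2)
  invFun x := (x.1 - c x.2, x.2)
  left_inv x := by simp
  right_inv x := by simp

/-- The scheme attains the capacity. -/
theorem achievable_capacity (hN : 2 ≤ N) (hMK : M < K) :
    AchievableNormCost N K M (∑ i ∈ Finset.range (K - M), (1 / (N : ℝ)) ^ i) := by
  let mT : MeasurableSpace (Equiv.Perm (QVec N K M)) := ⊤
  have : DiscreteMeasurableSpace (Equiv.Perm (QVec N K M)) := ⟨fun _ => trivial⟩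
  have : DiscreteMeasurableSpace (KeyedMsgs N K M) :=
    MeasurableSingletonClass.toDiscreteMeasurableSpace
  have hNR : (2 : ℝ) ≤ N := by exact_mod_cast hN
  have hJ : Fintype.card {j : Fin K // M ≤ (j : ℕ)} = K - M := by
    rw [Fintype.card_subtype]
    have : (Finset.univ.filter fun j : Fin K => M ≤ (j : ℕ)) = Finset.Ici ⟨M, hMK⟩ := by
      ext j; simp [Fin.le_def]
    rw [this, Fin.card_Ici]
  have hB : Fintype.card (QVec N K M) = N ^ (K - M) := by simp [hJ]
  have hW : ∀ i, entH (unifMeasure (KeyedMsgs N K M)) (fun ω : KeyedMsgs N K M => ω.1 i) =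
      N ^ (K - M) * (N - 1) * Real.log 2 := by
    intro i
    rw [entH_unifMeasure]
    · rw [Fintype.card_fun, Fintype.card_fun, Fintype.card_subtype_compl, hB]
      simp only [Fintype.card_fin, Fintype.card_unique]
      push_cast [Nat.cast_sub (show 1 ≤ N by omega)]
      rw [Real.log_pow, Real.log_pow]
      push_cast [Nat.cast_sub (show 1 ≤ N by omega)]
      ring
    · intro s s'
      refine ⟨translateFst fun _ _ => s' - s, fun ω => ?_⟩
      simp only [translateFst, Equiv.coe_fn_mk, Pi.add_apply]
      rw [← sub_eq_zero, ← sub_eq_zero (b := s')]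
      abel_nf
  have hA : ∀ k n, entH (unifMeasure (KeyedMsgs N K M))
      (fun ω : KeyedMsgs N K M => answer (query k n ω.2) ω.1) =
      (N ^ (K - M) - 1) * Real.log 2 := by
    intro k n
    rw [entH_unifMeasure]
    · rw [Fintype.card_fun, Fintype.card_subtype_compl, hB]
      simp only [Fintype.card_fin, Fintype.card_unique]
      push_cast
      rw [Real.log_pow, Nat.cast_sub (Nat.one_le_pow _ _ (by omega))]
      push_cast
      rfl
    · intro s s'
      choose c hc using fun σ : Equiv.Perm (QVec N K M) =>
        exists_answer_eq (query k n σ) (s' - s)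
      refine ⟨translateFst c, fun ω => ?_⟩
      simp only [translateFst, Equiv.coe_fn_mk, answer_add, hc]
      rw [← sub_eq_zero, ← sub_eq_zero (b := s')]
      abel_nf
  have hlog : 0 < Real.log 2 := Real.log_pos one_lt_two
  refine ⟨KeyedMsgs N K M, inferInstance, unifMeasure (KeyedMsgs N K M), Msg N K M,
    Equiv.Perm (QVec N K M), Ans N K M, inferInstance, inferInstance, inferInstance,
    inferInstance, inferInstance, inferInstance,
    inferInstance, inferInstance, inferInstance, fun i ω => ω.1 i, fun k n ω => query k n ω.2,
    fun k n ω => answer (query k n ω.2) ω.1, N ^ (K - M) * (N - 1) * Real.log 2, ?_, ?_, ?_⟩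
  · have : (0 : ℝ) < N - 1 := by linarith
    positivity
  · have htrans : ∀ (C : Set (KeyedMsgs N K M)),
        (∀ ω ω' : KeyedMsgs N K M, ω.2 = ω'.2 → (ω ∈ C ↔ ω' ∈ C)) →
        ∀ s s', ∃ e : KeyedMsgs N K M ≃ KeyedMsgs N K M,
          ∀ ω, (ω ∈ C ∧ ω.1 = s) ↔ (e ω ∈ C ∧ (e ω).1 = s') := by
      intro C hC s s'
      refine ⟨translateFst fun _ => s' - s, fun ω => ?_⟩
      rw [hC ω (translateFst (fun _ => s' - s) ω) rfl]
      refine and_congr_right fun _ => ?_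
      simp only [translateFst, Equiv.coe_fn_mk]
      rw [← sub_eq_zero, ← sub_eq_zero (b := s')]
      abel_nf
    have hall : ∀ w : Fin K → Msg N K M, unifMeasure (KeyedMsgs N K M) {ω | ω.1 = w} =
        (Fintype.card (Fin K → Msg N K M) : ENNReal)⁻¹ := fun w =>
      unifMeasure_fiber_univ (fun ω : KeyedMsgs N K M => ω.1)
        (by simpa using htrans Set.univ (by simp)) w
    refine ⟨inferInstance, fun _ => .of_discrete, fun _ _ => .of_discrete,
      fun _ _ => .of_discrete, hW, fun w => ?_, fun k _ q w => ?_, fun k _ n => ?_,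
      fun n k k' _ _ t u w => ?_, fun k hk => ?_⟩
    · have hone : ∀ i, unifMeasure (KeyedMsgs N K M) {ω | ω.1 i = w i} =
          (Fintype.card (Msg N K M) : ENNReal)⁻¹ := fun i => by
        refine unifMeasure_fiber_univ (fun ω : KeyedMsgs N K M => ω.1 i) (fun s s' => ?_) (w i)
        refine ⟨translateFst fun _ _ => s' - s, fun ω => ?_⟩
        simp only [translateFst, Equiv.coe_fn_mk, Pi.add_apply]
        rw [← sub_eq_zero, ← sub_eq_zero (b := s')]
        abel_nf
      simp_rw [hone, ← funext_iff]
      rw [hall, Finset.prod_const, Finset.card_univ, Fintype.card_fun, Nat.cast_pow,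
        ENNReal.inv_pow]
    · have h1 := unifMeasure_fiber {ω : KeyedMsgs N K M | ∀ n, query k n ω.2 = q n}
        (fun ω : KeyedMsgs N K M => ω.1)
        (htrans _ fun ω ω' h => by simp [h]) w
      simp_rw [← funext_iff (g := w)]
      rw [hall w]
      exact h1
    · exact condH_eq_zero _ _ fun ω ω' h => by
        simp only [Prod.mk.injEq] at h
        change answer _ _ = answer _ _
        rw [h.1, show ω.1 = ω'.1 from h.2]
    · have hpriv : ∀ k : Fin K, unifMeasure (KeyedMsgs N K M) {ω | query k n ω.2 = t ∧
          answer (query k n ω.2) ω.1 = u ∧ ∀ i, ω.1 i = w i} =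
          unifMeasure (KeyedMsgs N K M)
            {ω | ω.2 = t ∧ answer ω.2 ω.1 = u ∧ ∀ i, ω.1 i = w i} := fun k =>
        unifMeasure_preimage ((Equiv.refl _).prodCongr
          (Equiv.ofBijective _ (Finite.injective_iff_bijective.1 (query_injective k n))))
          {ω : KeyedMsgs N K M | ω.2 = t ∧ answer ω.2 ω.1 = u ∧ ∀ i, ω.1 i = w i}
      exact (hpriv k).trans (hpriv k').symm
    · refine (condH_eq_zero _ _ fun ω ω' h => ?_).le
      simp only [Prod.mk.injEq] at h
      obtain ⟨h1, h2, -⟩ := h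
      have hσ : ω.2 = ω'.2 := query_injective k 0 (congrFun h1 0)
      refine decode k hk ω.2 ω.1 ω'.1 fun n => ?_
      have := congrFun h2 n
      rwa [← hσ] at this
  · have : Nonempty {k : Fin K // M ≤ (k : ℕ)} := ⟨⟨⟨M, hMK⟩, le_rfl⟩⟩
    simp_rw [hA]
    rw [ciSup_const, Finset.sum_const, Finset.card_univ, Fintype.card_fin, nsmul_eq_mul,
      geom_sum_eq (by rw [Ne, div_eq_one_iff_eq (by linarith)]; linarith)]
    have h1 : (N : ℝ) - 1 ≠ 0 := by linarith
    have h2 : (N : ℝ) ≠ 0 := by linarith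
    have h3 : (1 : ℝ) - N ≠ 0 := by linarith
    have h4 : (1 : ℝ) / N - 1 ≠ 0 := by
      rw [div_sub_one h2]
      exact div_ne_zero h3 h2
    rw [one_div_pow]
    field_simp
    ring

end Scheme

/-- **Capacity of PIR with partially known private side information (Theorem 1, zero-error
form).** Assume `N ∣ M`. The set of achievable normalized download costs has least element
(attained infimum) `∑_{i=0}^{K−M−1} (1/N)^i = (1 − (1/N)^{K−M})/(1 − 1/N)`; equivalently,
the capacity (its reciprocal) equals `C = (1 − 1/N)/(1 − (1/N)^{K−M})`. -/
theorem capacity_partially_known_side_information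
    (N K M : ℕ) (hN : 2 ≤ N) (hK : 2 ≤ K) (hMK : M < K) (hdvd : N ∣ M) :
    IsLeast {x : ℝ | AchievableNormCost N K M x}
        (∑ i ∈ Finset.range (K - M), (1 / (N : ℝ)) ^ i) ∧
    (∑ i ∈ Finset.range (K - M), (1 / (N : ℝ)) ^ i) =
        (1 - (1 / (N : ℝ)) ^ (K - M)) / (1 - 1 / (N : ℝ)) ∧
    (∑ i ∈ Finset.range (K - M), (1 / (N : ℝ)) ^ i)⁻¹ =
        (1 - 1 / (N : ℝ)) / (1 - (1 / (N : ℝ)) ^ (K - M)) := by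

  have hNR : (2 : ℝ) ≤ N := by exact_mod_cast hN
  have hne : 1 / (N : ℝ) ≠ 1 := by
    rw [Ne, div_eq_one_iff_eq (by linarith)]
    linarith
  have hgeom : (∑ i ∈ Finset.range (K - M), (1 / (N : ℝ)) ^ i) =
      (1 - (1 / (N : ℝ)) ^ (K - M)) / (1 - 1 / (N : ℝ)) := by
    rw [geom_sum_eq hne, ← neg_div_neg_eq, neg_sub, neg_sub]
  refine ⟨⟨?_, ?_⟩, hgeom, ?_⟩
  · have : NeZero N := ⟨by omega⟩
    exact achievable_capacity hN hMK
  · rintro x ⟨Ω, _, μ, S, T, U, _, _, _, _, _, _, _, _, _, W, Q, A, ℓ, hℓ, h, rfl⟩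
    rw [le_div_iff₀ hℓ, mul_comm]
    exact (le_sum_entH_answers (by omega) h (k := ⟨M, hMK⟩) rfl).trans
      (le_ciSup (f := fun k : {k : Fin K // M ≤ (k : ℕ)} => ∑ n : Fin N, entH μ (A k.1 n))
        (Set.finite_range _).bddAbove ⟨⟨M, hMK⟩, le_rfl⟩)
  · rw [hgeom, inv_div]
end

section
/- Achievability (Theorem 1, achievable direction, uniform prefetching): Let N ≥ 2, m ≥ 1 be integers, set M = N·m, and let K > M be an integer. Then there exists a perfectly reliable scheme (as defined in the context, with ε = 0) in which each message W_i is uniformly distributed on the vectors of length N^{K−m} over a finite field, so that H(W_i) = ℓ for a common ℓ > 0, and such that for every k ∈ {M+1, …, K}, Σ_{n=1}^N H(A_n^[k]) ≤ ℓ · Σ_{i=0}^{K−M−1} (1/N)^i. -/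
open MeasureTheory

/-- Extend a function on the nonzero elements of `Fin N` by `0` at `0`. -/
def extendZero {N : ℕ} [NeZero N] {G : Type*} [Zero G]
    (g : {s : Fin N // s ≠ 0} → G) (s : Fin N) : G :=
  if h : s = 0 then 0 else g ⟨s, h⟩

/-- The answer to the query `q`: the `v`-th symbol is the sum over the messages `i` of the symbol
number `v i` of block `v - q` of message `i`, where symbol number `0` of each block is zero. -/
def pirAnswer {I : Type*} [Fintype I] {N : ℕ} [NeZero N] {G : Type*} [AddCommGroup G]
    (w : I → (I → Fin N) → {s : Fin N // s ≠ 0} → G) (q : I → Fin N)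
    (v : {v : I → Fin N // v ≠ 0}) : G :=
  ∑ i, extendZero (w i (v.1 - q)) (v.1 i)

theorem pirAnswer_decodable {I : Type*} [Fintype I] [DecidableEq I] {N : ℕ} [NeZero N]
    {G : Type*} [AddCommGroup G] {w w' : I → (I → Fin N) → {s : Fin N // s ≠ 0} → G}
    {q : I → Fin N} {k : I}
    (h : ∀ n, pirAnswer w (q + Pi.single k n) = pirAnswer w' (q + Pi.single k n)) :
    w k = w' k := by
  funext j s
  have key : ∀ c : Fin N, ∑ i, extendZero (w i j) (Function.update (q + j) k c i) =
      ∑ i, extendZero (w' i j) (Function.update (q + j) k c i) := by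
    intro c
    by_cases hv : Function.update (q + j) k c = 0
    · simp [hv, extendZero]
    · have hj : Function.update (q + j) k c - (q + Pi.single k (c - (q + j) k)) = j := by
        funext i
        by_cases hi : i = k
        · subst hi
          simp only [Pi.sub_apply, Pi.add_apply, Function.update_self, Pi.single_eq_same]
          abel
        · simp [hi]
      have := congrFun (h (c - (q + j) k)) ⟨_, hv⟩
      simpa only [pirAnswer, hj] using this
  have split : ∀ (u : I → (I → Fin N) → {s : Fin N // s ≠ 0} → G) (c : Fin N),
      ∑ i, extendZero (u i j) (Function.update (q + j) k c i) =
        extendZero (u k j) c + ∑ i ∈ Finset.univ.erase k, extendZero (u i j) ((q + j) i) := by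
    intro u c
    rw [← Finset.add_sum_erase _ _ (Finset.mem_univ k), Function.update_self]
    congr 1
    refine Finset.sum_congr rfl fun i hi => ?_
    rw [Function.update_of_ne (Finset.ne_of_mem_erase hi)]
  have h0 := key 0
  have hs := key s.1
  rw [split, split] at h0 hs
  have hz : ∀ g : {s : Fin N // s ≠ 0} → G, extendZero g 0 = 0 := fun g => dif_pos rfl
  rw [hz, hz, zero_add, zero_add] at h0
  rw [h0] at hs
  simpa [extendZero, s.2] using hs

theorem condH_eq_zero_of_factorsThrough {Ω : Type*} [MeasurableSpace Ω] (μ : Measure Ω)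
    {S T : Type*} [Fintype S] [Fintype T] {X : Ω → S} {Y : Ω → T}
    (h : Function.FactorsThrough X Y) : condH μ X Y = 0 := by
  classical
  rw [condH, sub_eq_zero, entH, entH, Fintype.sum_prod_type_right]
  refine Finset.sum_congr rfl fun t _ => ?_
  by_cases ht : ∃ ω, Y ω = t
  · obtain ⟨ω, rfl⟩ := ht
    rw [Finset.sum_eq_single (X ω)]
    · congr 3
      ext ω'
      simpa using fun hY => h hY
    · intro s _ hs
      have : (fun ω' => (X ω', Y ω')) ⁻¹' {(s, Y ω)} = ∅ := by
        ext ω'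
        simp only [Set.mem_preimage, Set.mem_singleton_iff, Prod.mk.injEq, Set.mem_empty_iff_false,
          iff_false, not_and]
        exact fun hX hY => hs (hX ▸ h hY)
      simp [this]
    · simp
  · have hY : Y ⁻¹' {t} = ∅ := by
      ext ω
      simpa using fun hω => ht ⟨ω, hω⟩
    have hXY : ∀ s, (fun ω' => (X ω', Y ω')) ⁻¹' {(s, t)} = ∅ := by
      intro s
      ext ω
      simpa using fun _ hω => ht ⟨ω, hω⟩
    simp [hY, hXY]

theorem entH_le_log_card {Ω : Type*} [MeasurableSpace Ω] (μ : Measure Ω) [IsProbabilityMeasure μ]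
    {S : Type*} [Fintype S] [MeasurableSpace S] [MeasurableSingletonClass S] {X : Ω → S}
    (hX : Measurable X) : entH μ X ≤ Real.log (Fintype.card S) := by
  have hsum : ∑ s : S, (μ (X ⁻¹' {s})).toReal = 1 := by
    rw [← ENNReal.toReal_sum fun s _ => measure_ne_top _ _,
      sum_measure_preimage_singleton _ fun s _ => hX (measurableSet_singleton s)]
    simp
  have hcard : (0 : ℝ) < Fintype.card S := by
    have : Nonempty S := by
      by_contra hS
      rw [not_nonempty_iff] at hS
      simp at hsum
    exact_mod_cast Fintype.card_pos
  have := Real.concaveOn_negMulLog.le_map_sum (t := Finset.univ)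
    (w := fun _ : S => (Fintype.card S : ℝ)⁻¹) (p := fun s => (μ (X ⁻¹' {s})).toReal)
    (fun _ _ => by positivity) (by simp [hcard.ne']) (fun _ _ => ENNReal.toReal_nonneg)
  simp only [smul_eq_mul, ← Finset.mul_sum, hsum, mul_one, Real.negMulLog, Real.log_inv] at this
  rw [neg_mul_neg] at this
  exact le_of_mul_le_mul_left this (by positivity)

theorem entH_eq_log_card {Ω : Type*} [MeasurableSpace Ω] (μ : Measure Ω)
    {S : Type*} [Fintype S] [Nonempty S] {X : Ω → S}
    (hX : ∀ s, μ (X ⁻¹' {s}) = (Fintype.card S : ENNReal)⁻¹) :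
    entH μ X = Real.log (Fintype.card S) := by
  simp [entH, hX, Real.negMulLog]

/-- The uniform probability measure on a finite type. -/
noncomputable def uniformMeasure (α : Type*) [Fintype α] [Nonempty α] [MeasurableSpace α] :
    Measure α :=
  (PMF.uniformOfFintype α).toMeasure

instance (α : Type*) [Fintype α] [Nonempty α] [MeasurableSpace α] :
    IsProbabilityMeasure (uniformMeasure α) := by
  unfold uniformMeasure
  infer_instance

theorem uniformMeasure_singleton {α : Type*} [Fintype α] [Nonempty α] [MeasurableSpace α]
    [MeasurableSingletonClass α] (a : α) :
    uniformMeasure α {a} = (Fintype.card α : ENNReal)⁻¹ := by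
  rw [uniformMeasure, PMF.toMeasure_apply_singleton _ _ (measurableSet_singleton a),
    PMF.uniformOfFintype_apply]

theorem pirScheme_hyps {N K M : ℕ} [NeZero N] {S G : Type*} [Fintype S] [Nonempty S]
    [MeasurableSpace S] [MeasurableSingletonClass S] [AddCommGroup G] [Fintype G]
    [MeasurableSpace ({i : Fin K // M ≤ (i : ℕ)} → Fin N)]
    [DiscreteMeasurableSpace ({i : Fin K // M ≤ (i : ℕ)} → Fin N)]
    [MeasurableSpace ({v : {i : Fin K // M ≤ (i : ℕ)} → Fin N // v ≠ 0} → G)]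
    [MeasurableSingletonClass ({v : {i : Fin K // M ≤ (i : ℕ)} → Fin N // v ≠ 0} → G)]
    (e : S ≃ (({i : Fin K // M ≤ (i : ℕ)} → Fin N) → {s : Fin N // s ≠ 0} → G))
    (Q : Fin K → Fin N → ({i : Fin K // M ≤ (i : ℕ)} → Fin N) → _)
    (hQ : ∀ (k : Fin K) (hk : M ≤ (k : ℕ)) n x, Q k n x = x + Pi.single ⟨k, hk⟩ n) :
    SchemeHyps N K M
      ((uniformMeasure ({i : Fin K // M ≤ (i : ℕ)} → Fin N)).prod
        (Measure.pi fun _ : Fin K => uniformMeasure S))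
      (fun i ω => ω.2 i) (fun k n ω => Q k n ω.1)
      (fun k n ω => pirAnswer (fun i => e (ω.2 i.1)) (Q k n ω.1))
      (Real.log (Fintype.card S)) 0 ∧
    ∀ (i : Fin K) (v : S), ((uniformMeasure ({i : Fin K // M ≤ (i : ℕ)} → Fin N)).prod
        (Measure.pi fun _ : Fin K => uniformMeasure S)) {ω | ω.2 i = v} =
          (Fintype.card S : ENNReal)⁻¹ := by
  have hW : ∀ (i : Fin K) (v : S), ((uniformMeasure ({i : Fin K // M ≤ (i : ℕ)} → Fin N)).prod
        (Measure.pi fun _ : Fin K => uniformMeasure S)) {ω | ω.2 i = v} =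
          (Fintype.card S : ENNReal)⁻¹ := by
    intro i v
    have hset : {ω : ({i : Fin K // M ≤ (i : ℕ)} → Fin N) × (Fin K → S) | ω.2 i = v} =
        Set.univ ×ˢ (Function.eval i ⁻¹' ({v} : Set S)) := by
      ext; simp
    rw [hset, Measure.prod_prod, measure_univ, one_mul,
      (measurePreserving_eval (fun _ : Fin K => uniformMeasure S) i).measure_preimage
        (measurableSet_singleton v).nullMeasurableSet, uniformMeasure_singleton]
  have hWs : ∀ w : Fin K → S, {ω : ({i : Fin K // M ≤ (i : ℕ)} → Fin N) × (Fin K → S) |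
      ∀ i, ω.2 i = w i} = Set.univ ×ˢ {w} := by
    intro w
    ext ω
    simp [funext_iff]
  refine ⟨⟨inferInstance, fun _ => .of_discrete, fun _ _ => .of_discrete, fun _ _ => .of_discrete,
    fun i => entH_eq_log_card _ (hW i), fun w => ?_, fun k _ q w => ?_, fun k _ n => ?_,
    fun n k k' hk hk' t u w => ?_, fun k hk => ?_⟩, hW⟩
  · simp_rw [hW, hWs, Measure.prod_prod, measure_univ, one_mul, Measure.pi_singleton,
      uniformMeasure_singleton]
  · have h₁ : {ω : ({i : Fin K // M ≤ (i : ℕ)} → Fin N) × (Fin K → S) |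
        (∀ n, Q k n ω.1 = q n) ∧ ∀ i, ω.2 i = w i} = {x | ∀ n, Q k n x = q n} ×ˢ {w} := by
      ext ω
      simp [funext_iff]
    have h₂ : {ω : ({i : Fin K // M ≤ (i : ℕ)} → Fin N) × (Fin K → S) |
        ∀ n, Q k n ω.1 = q n} = {x | ∀ n, Q k n x = q n} ×ˢ Set.univ := by
      ext ω
      simp
    rw [hWs, h₁, h₂]
    simp only [Measure.prod_prod, measure_univ, one_mul, mul_one]
  · refine condH_eq_zero_of_factorsThrough _ fun ω ω' h => ?_
    simp only [Prod.mk.injEq] at h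
    have h₂ : ω.2 = ω'.2 := h.2
    simp only [h.1, h₂]
  · have hset : ∀ (k : Fin K) (hk : M ≤ (k : ℕ)),
        {ω : ({i : Fin K // M ≤ (i : ℕ)} → Fin N) × (Fin K → S) |
          Q k n ω.1 = t ∧ pirAnswer (fun i => e (ω.2 i.1)) (Q k n ω.1) = u ∧ ∀ i, ω.2 i = w i} =
        {t - Pi.single ⟨k, hk⟩ n} ×ˢ
          {w' | pirAnswer (fun i => e (w' i.1)) t = u ∧ ∀ i, w' i = w i} := by
      intro k hk
      ext ω
      simp only [Set.mem_ofPred_eq, Set.mem_prod, Set.mem_singleton_iff, eq_sub_iff_add_eq,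
        ← hQ k hk]
      refine and_congr_right fun h => ?_
      rw [h]
    rw [hset k hk, hset k' hk', Measure.prod_prod, Measure.prod_prod, uniformMeasure_singleton,
      uniformMeasure_singleton]
  · refine (condH_eq_zero_of_factorsThrough _ fun ω ω' h => ?_).le
    simp only [Prod.mk.injEq, hQ k hk] at h
    obtain ⟨hq, ha, -⟩ := h
    have hx : ω.1 = ω'.1 := add_right_cancel (congrFun hq 0)
    rw [← hx] at ha
    exact e.injective (pirAnswer_decodable (w := fun i => e (ω.2 i.1))
      (w' := fun i => e (ω'.2 i.1)) (k := ⟨k, hk⟩) fun n => congrFun ha n)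

theorem mul_pow_sub_one_eq_mul_geom_sum {N : ℕ} (hN : 1 ≤ N) (d : ℕ) :
    (N : ℝ) * (N ^ d - 1) = N ^ d * (N - 1) * ∑ i ∈ Finset.range d, (1 / (N : ℝ)) ^ i := by
  have hN' : (N : ℝ) ≠ 0 := by positivity
  simp only [one_div, inv_pow]
  induction d with
  | zero => simp
  | succ d ih =>
    rw [Finset.sum_range_succ, mul_add, pow_succ,
      show (N : ℝ) ^ d * N * (N - 1) * ∑ i ∈ Finset.range d, ((N : ℝ) ^ i)⁻¹ =
        N * (N ^ d * (N - 1) * ∑ i ∈ Finset.range d, ((N : ℝ) ^ i)⁻¹) by ring, ← ih]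
    field_simp
    ring

/-- **Achievability (Theorem 1, achievable direction, uniform prefetching).** Let `N ≥ 2`,
`m ≥ 1`, `M = N·m`, and `K > M`. There exists a perfectly reliable scheme (`ε = 0`) in which
each message `W i` is uniformly distributed on the vectors of length `N^{K−m}` over a finite
field `F` (so `H(W i) = ℓ` for a common `ℓ > 0`), and such that for every desired index
`k ∈ {M+1, …, K}` (0-indexed: `k : Fin K` with `M ≤ k`), the download cost satisfies
`∑ₙ H(Aₙ^[k]) ≤ ℓ·∑_{i=0}^{K−M−1} (1/N)^i`. -/
theorem achievability_uniform_prefetching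
    (N m : ℕ) (hN : 2 ≤ N) (hm : 1 ≤ m) (K : ℕ) (hK : N * m < K) :
    ∃ (Ω : Type) (_ : MeasurableSpace Ω) (μ : Measure Ω)
      (F : Type) (_ : Field F) (_ : Fintype F)
      (_ : MeasurableSpace (Fin (N ^ (K - m)) → F))
      (_ : MeasurableSingletonClass (Fin (N ^ (K - m)) → F))
      (T U : Type) (_ : Fintype T) (_ : Fintype U)
      (_ : MeasurableSpace T) (_ : MeasurableSpace U)
      (_ : MeasurableSingletonClass T) (_ : MeasurableSingletonClass U)
      (W : Fin K → Ω → (Fin (N ^ (K - m)) → F))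
      (Q : Fin K → Fin N → Ω → T) (A : Fin K → Fin N → Ω → U)
      (ℓ : ℝ), 0 < ℓ ∧
      SchemeHyps N K (N * m) μ W Q A ℓ 0 ∧
      (∀ (i : Fin K) (v : Fin (N ^ (K - m)) → F),
        μ {ω | W i ω = v} = ((Fintype.card (Fin (N ^ (K - m)) → F) : ENNReal))⁻¹) ∧
      (∀ k : Fin K, N * m ≤ (k : ℕ) →
        (∑ n : Fin N, entH μ (A k n)) ≤
          ℓ * ∑ i ∈ Finset.range (K - N * m), (1 / (N : ℝ)) ^ i) := by
  classical
  have : NeZero N := ⟨by omega⟩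
  let I := {i : Fin K // N * m ≤ (i : ℕ)}
  let X := I → Fin N
  let F := GaloisField 2 (N - 1)
  let _ : Fintype F := Fintype.ofFinite F
  let G := Fin (N ^ (N * m - m)) → ZMod 2
  let U := {v : X // v ≠ 0} → G
  let S := Fin (N ^ (K - m)) → F
  let _ : MeasurableSpace S := ⊤
  let _ : MeasurableSpace U := ⊤
  have hmM : m ≤ N * m := Nat.le_mul_of_pos_left m (by omega)
  have hX : Fintype.card X = N ^ (K - N * m) := by
    have hI : Fintype.card I = K - N * m := by
      rw [Fintype.card_subtype]
      have := Fin.card_filter_val_lt (m := N * m) (n := K)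
      have h := Finset.card_filter_add_card_filter_not (s := (Finset.univ : Finset (Fin K)))
        (fun i => (i : ℕ) < N * m)
      simp only [not_lt, Finset.card_univ, Fintype.card_fin] at h
      omega
    simp [X, hI]
  have hF : Fintype.card F = 2 ^ (N - 1) := by
    rw [← Nat.card_eq_fintype_card, GaloisField.card 2 _ (by omega)]
  have hG : Fintype.card G = 2 ^ N ^ (N * m - m) := by simp [G]
  have hs : Fintype.card {s : Fin N // s ≠ 0} = N - 1 := by
    simp [Fintype.card_subtype_compl]
  have hU : Fintype.card U = Fintype.card G ^ (N ^ (K - N * m) - 1) := by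
    rw [Fintype.card_fun, ← hX]
    simp [Fintype.card_subtype_compl]
  have hS : Fintype.card S = Fintype.card G ^ (N ^ (K - N * m) * (N - 1)) := by
    rw [Fintype.card_fun, Fintype.card_fin, hF, hG, ← pow_mul, ← pow_mul,
      show K - m = (N * m - m) + (K - N * m) by omega, pow_add]
    congr 1
    ring
  have e : S ≃ (X → {s : Fin N // s ≠ 0} → G) := by
    refine Fintype.equivOfCardEq ?_
    rw [hS, Fintype.card_fun (α := X), Fintype.card_fun (α := {s : Fin N // s ≠ 0}) (β := G), hX,
      hs, ← pow_mul, mul_comm (N - 1)]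
  have hG1 : 1 < Fintype.card G := by
    rw [hG]
    exact Nat.one_lt_two_pow (by positivity)
  have hlogG : 0 < Real.log (Fintype.card G) := Real.log_pos (by exact_mod_cast hG1)
  let Q : Fin K → Fin N → X → X := fun k n x =>
    if hk : N * m ≤ (k : ℕ) then x + Pi.single ⟨k, hk⟩ n else x
  obtain ⟨hyps, hunif⟩ := pirScheme_hyps e Q fun k hk n x => dif_pos hk
  refine ⟨X × (Fin K → S), inferInstance, _, F, inferInstance, inferInstance, inferInstance,
    inferInstance, X, U, inferInstance, inferInstance, inferInstance, inferInstance, inferInstance,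
    inferInstance, _, _, _, _, ?_, hyps, hunif, fun k _ => ?_⟩
  · rw [hS, Nat.cast_pow, Real.log_pow]
    have : 0 < N ^ (K - N * m) * (N - 1) := Nat.mul_pos (by positivity) (by omega)
    positivity
  · calc _ ≤ ∑ _n : Fin N, Real.log (Fintype.card U) :=
          Finset.sum_le_sum fun n _ => entH_le_log_card _ .of_discrete
      _ = N * (N ^ (K - N * m) - 1) * Real.log (Fintype.card G) := by
          rw [hU, Nat.cast_pow, Real.log_pow, Nat.cast_sub (Nat.one_le_pow _ _ (by omega))]
          simp [mul_assoc]
      _ = _ := by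
          rw [mul_pow_sub_one_eq_mul_geom_sum (by omega), hS, Nat.cast_pow, Real.log_pow,
            Nat.cast_mul, Nat.cast_sub (by omega)]
          push_cast
          ring
end
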